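/- arXiv:1807.11211 — 11 statements merged into one kernel-verified Lean document; each statement's English description precedes it below -/
import Mathlib

section
/- Every triple system on a 6-element vertex set with at least 9 triples contains a Berge-K4. -/
/-- `HasBergeK4 H` : `H` contains a Berge-`K₄`, i.e. four distinct vertices
`v₁, v₂, v₃, v₄` and six pairwise distinct triples `e_{ij} ∈ H` with
`{vᵢ, vⱼ} ⊆ e_{ij}` for every `1 ≤ i < j ≤ 4`. -/
def HasBergeK4 {V : Type*} [DecidableEq V] (H : Finset (Finset V)) : Prop :=
  ∃ v₁ v₂ v₃ v₄ : V, ∃ e₁₂ e₁₃ e₁₄ e₂₃ e₂₄ e₃₄ : Finset V,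
    v₁ ≠ v₂ ∧ v₁ ≠ v₃ ∧ v₁ ≠ v₄ ∧ v₂ ≠ v₃ ∧ v₂ ≠ v₄ ∧ v₃ ≠ v₄ ∧
    ([e₁₂, e₁₃, e₁₄, e₂₃, e₂₄, e₃₄] : List (Finset V)).Nodup ∧
    e₁₂ ∈ H ∧ e₁₃ ∈ H ∧ e₁₄ ∈ H ∧ e₂₃ ∈ H ∧ e₂₄ ∈ H ∧ e₃₄ ∈ H ∧
    {v₁, v₂} ⊆ e₁₂ ∧ {v₁, v₃} ⊆ e₁₃ ∧ {v₁, v₄} ⊆ e₁₄ ∧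
    {v₂, v₃} ⊆ e₂₃ ∧ {v₂, v₄} ⊆ e₂₄ ∧ {v₃, v₄} ⊆ e₃₄

/-! The proof labels the vertices by `0, …, 5`, encodes a triple by the natural number whose
binary digits mark its elements, and a triple system by the natural number whose binary digits
mark the codes of its members.  Some pair lies in two triples, which may be labelled `{0, 1, 2}`
and `{0, 1, 3}`; a backtracking search evaluated by the kernel handles the remaining triples. -/

namespace BergeSearch

/-- Call `f` on `m`. Recursing on `m` makes the kernel evaluate `m` first. -/
def force (m : ℕ) (f : ℕ → Bool) : Bool := m.rec (f 0) fun k _ => f k.succ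

theorem force_eq (m : ℕ) (f : ℕ → Bool) : force m f = f m := by
  cases m <;> rfl

/-- The lists `ls` have a system of distinct representatives among the binary digits of `m`. -/
def hasTransversal (ls : List (List ℕ)) : ℕ → Bool :=
  ls.rec (fun _ => true) fun l _ ih m =>
    l.rec false fun c _ ih' =>
      (Nat.beq (Nat.land m (Nat.pow 2 c)) 0).rec
        ((ih (Nat.xor m (Nat.pow 2 c))).rec ih' true) ih'

/-- Every mask in `l` meets `m`. -/
def allMeet (l : List ℕ) (m : ℕ) : Bool :=
  l.rec true fun a _ ih => (Nat.beq (Nat.land m a) 0).rec ih false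

/-- Four vertices and, for each of the six pairs of them, the list of codes of the triples
containing the pair, together with that list's binary mask. -/
structure QuadData where
  a : ℕ
  b : ℕ
  c : ℕ
  d : ℕ
  masks : List ℕ
  covers : List (List ℕ)

/-- The quadruples of vertices among `0, …, 5`. -/
def quadTable : List QuadData :=
  [ ⟨0, 1, 2, 3,
      [34360264832, 137441058944, 2199056820224, 274882117760, 4398113638400, 17592454504448],
      [[19, 35, 7, 11], [21, 37, 7, 13], [25, 41, 11, 13], [22, 38, 7, 14], [26, 42, 11, 14], [28, 44, 13, 14]]⟩,
    ⟨0, 1, 2, 4,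
      [34360264832, 137441058944, 562949989597184, 274882117760, 1125899978670080, 4503599902097408],
      [[11, 35, 7, 19], [13, 37, 7, 21], [25, 49, 19, 21], [14, 38, 7, 22], [26, 50, 19, 22], [28, 52, 21, 22]]⟩,
    ⟨0, 1, 2, 5,
      [34360264832, 137441058944, 565320775368704, 274882117760, 1130607190999040, 4521604130275328],
      [[11, 19, 7, 35], [13, 21, 7, 37], [41, 49, 35, 37], [14, 22, 7, 38], [42, 50, 35, 38], [44, 52, 37, 38]]⟩,
    ⟨0, 1, 3, 4,
      [34360264832, 2199056820224, 562949989597184, 4398113638400, 1125899978670080, 72057594407026688],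
      [[7, 35, 11, 19], [13, 41, 11, 25], [21, 49, 19, 25], [14, 42, 11, 26], [22, 50, 19, 26], [28, 56, 25, 26]]⟩,
    ⟨0, 1, 3, 5,
      [34360264832, 2199056820224, 565320775368704, 4398113638400, 1130607190999040, 72081783293739008],
      [[7, 19, 11, 35], [13, 25, 11, 41], [37, 49, 35, 41], [14, 26, 11, 42], [38, 50, 35, 42], [44, 56, 41, 42]]⟩,
    ⟨0, 1, 4, 5,
      [34360264832, 562949989597184, 565320775368704, 1125899978670080, 1130607190999040, 78250043525562368],
      [[7, 11, 19, 35], [21, 25, 19, 49], [37, 41, 35, 49], [22, 26, 19, 50], [38, 42, 35, 50], [52, 56, 49, 50]]⟩,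
    ⟨0, 2, 3, 4,
      [137441058944, 2199056820224, 562949989597184, 17592454504448, 4503599902097408, 72057594407026688],
      [[7, 37, 13, 21], [11, 41, 13, 25], [19, 49, 21, 25], [14, 44, 13, 28], [22, 52, 21, 28], [26, 56, 25, 28]]⟩,
    ⟨0, 2, 3, 5,
      [137441058944, 2199056820224, 565320775368704, 17592454504448, 4521604130275328, 72081783293739008],
      [[7, 21, 13, 37], [11, 25, 13, 41], [35, 49, 37, 41], [14, 28, 13, 44], [38, 52, 37, 44], [42, 56, 41, 44]]⟩,
    ⟨0, 2, 4, 5,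
      [137441058944, 562949989597184, 565320775368704, 4503599902097408, 4521604130275328, 78250043525562368],
      [[7, 13, 21, 37], [19, 25, 21, 49], [35, 41, 37, 49], [22, 28, 21, 52], [38, 44, 37, 52], [50, 56, 49, 52]]⟩,
    ⟨0, 3, 4, 5,
      [2199056820224, 562949989597184, 565320775368704, 72057594407026688, 72081783293739008, 78250043525562368],
      [[11, 13, 25, 41], [19, 21, 25, 49], [35, 37, 41, 49], [26, 28, 25, 56], [42, 44, 41, 56], [50, 52, 49, 56]]⟩,
    ⟨1, 2, 3, 4,
      [274882117760, 4398113638400, 1125899978670080, 17592454504448, 4503599902097408, 72057594407026688],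
      [[7, 38, 14, 22], [11, 42, 14, 26], [19, 50, 22, 26], [13, 44, 14, 28], [21, 52, 22, 28], [25, 56, 26, 28]]⟩,
    ⟨1, 2, 3, 5,
      [274882117760, 4398113638400, 1130607190999040, 17592454504448, 4521604130275328, 72081783293739008],
      [[7, 22, 14, 38], [11, 26, 14, 42], [35, 50, 38, 42], [13, 28, 14, 44], [37, 52, 38, 44], [41, 56, 42, 44]]⟩,
    ⟨1, 2, 4, 5,
      [274882117760, 1125899978670080, 1130607190999040, 4503599902097408, 4521604130275328, 78250043525562368],
      [[7, 14, 22, 38], [19, 26, 22, 50], [35, 42, 38, 50], [21, 28, 22, 52], [37, 44, 38, 52], [49, 56, 50, 52]]⟩,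
    ⟨1, 3, 4, 5,
      [4398113638400, 1125899978670080, 1130607190999040, 72057594407026688, 72081783293739008, 78250043525562368],
      [[11, 14, 26, 42], [19, 22, 26, 50], [35, 38, 42, 50], [25, 28, 26, 56], [41, 44, 42, 56], [49, 52, 50, 56]]⟩,
    ⟨2, 3, 4, 5,
      [17592454504448, 4503599902097408, 4521604130275328, 72057594407026688, 72081783293739008, 78250043525562368],
      [[13, 14, 28, 44], [21, 22, 28, 52], [37, 38, 44, 52], [25, 26, 28, 56], [41, 42, 44, 56], [49, 50, 52, 56]]⟩ ]

/-- `m` encodes a triple system with a Berge-`K₄`. -/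
def hasBerge (m : ℕ) : Bool :=
  quadTable.rec false fun q _ ih =>
    (allMeet q.masks m).rec ih ((hasTransversal q.covers m).rec ih true)

/-- Every system obtained from `m` by adding all but at most `s` of the triples in `cs`
contains a Berge-`K₄`. -/
def search (cs : List ℕ) : ℕ → ℕ → Bool :=
  cs.rec (fun _ _ => false) fun c _ ih s m =>
    force (Nat.lor m (Nat.pow 2 c)) (fun m' => (hasBerge m').rec (ih s m') true) &&
      s.rec true fun s _ => ih s m

/-- The codes of all triples other than `{0, 1, 2}` and `{0, 1, 3}`. -/
def codes : List ℕ :=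
  [13, 56, 41, 37, 44, 38, 42, 35, 14, 52, 49, 50, 28, 21, 26, 22, 25, 19]

theorem search_codes : search codes 11 (2 ^ 7 + 2 ^ 11) = true := by
  decide +kernel

theorem testBit_of_land_pow_ne_zero {m c : ℕ} (h : Nat.beq (Nat.land m (Nat.pow 2 c)) 0 = false) :
    m.testBit c = true := by
  by_contra hc
  have h0 : Nat.land m (Nat.pow 2 c) = 0 := by
    change m &&& 2 ^ c = 0
    rw [Nat.and_two_pow, Bool.eq_false_iff.2 hc]
    simp
  rw [h0] at h
  exact absurd h (by decide)

theorem exists_of_hasTransversal (ls : List (List ℕ)) (m : ℕ) (h : hasTransversal ls m = true) :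
    ∃ es : List ℕ, List.Forall₂ (· ∈ ·) es ls ∧ es.Nodup ∧ ∀ c ∈ es, m.testBit c = true := by
  induction ls generalizing m with
  | nil => exact ⟨[], by simp⟩
  | cons l ls ih =>
    have key : ∃ c ∈ l, m.testBit c = true ∧ hasTransversal ls (m ^^^ 2 ^ c) = true := by
      change (l.rec false fun c _ ih' =>
        (Nat.beq (Nat.land m (Nat.pow 2 c)) 0).rec
          ((hasTransversal ls (m ^^^ 2 ^ c)).rec ih' true) ih' : Bool) = true at h
      induction l with
      | nil => simp at h
      | cons c l ihl =>
        rcases hb : Nat.beq (Nat.land m (Nat.pow 2 c)) 0 with _ | _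
        · rcases ht : hasTransversal ls (m ^^^ 2 ^ c) with _ | _
          · simp only [hb, ht] at h
            obtain ⟨c', h1, h2⟩ := ihl h
            exact ⟨c', List.mem_cons_of_mem _ h1, h2⟩
          · exact ⟨c, List.mem_cons_self, testBit_of_land_pow_ne_zero hb, ht⟩
        · simp only [hb] at h
          obtain ⟨c', h1, h2⟩ := ihl h
          exact ⟨c', List.mem_cons_of_mem _ h1, h2⟩
    obtain ⟨c, hcl, hcm, ht⟩ := key
    obtain ⟨es, h1, h2, h3⟩ := ih _ ht
    have hbit : ∀ x ∈ es, x ≠ c ∧ m.testBit x = true := by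
      intro x hx
      have hx' := h3 x hx
      rw [Nat.testBit_xor, Nat.testBit_two_pow] at hx'
      by_cases hxc : c = x
      · subst hxc
        simp [hcm] at hx'
      · exact ⟨Ne.symm hxc, by simpa [hxc] using hx'⟩
    refine ⟨c :: es, List.Forall₂.cons hcl h1, List.nodup_cons.2 ⟨?_, h2⟩, ?_⟩
    · exact fun hc => (hbit c hc).1 rfl
    · intro x hx
      rcases List.mem_cons.1 hx with rfl | hx
      · exact hcm
      · exact (hbit x hx).2

theorem exists_of_hasBerge (m : ℕ) (h : hasBerge m = true) :
    ∃ q ∈ quadTable, hasTransversal q.covers m = true := by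
  unfold hasBerge at h
  generalize quadTable = l at h ⊢
  induction l with
  | nil => simp at h
  | cons q l ih =>
    rcases ht : hasTransversal q.covers m with _ | _
    · rcases ha : allMeet q.masks m with _ | _ <;> simp only [ha, ht] at h <;>
      · obtain ⟨q', h1, h2⟩ := ih h
        exact ⟨q', List.mem_cons_of_mem _ h1, h2⟩
    · exact ⟨q, List.mem_cons_self, ht⟩

theorem exists_of_search (P : ℕ → Prop) [DecidablePred P] (cs : List ℕ) (s m : ℕ)
    (h : search cs s m = true) (hcs : cs.countP (¬ P ·) ≤ s)
    (hm : ∀ c, m.testBit c = true → P c) :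
    ∃ m', hasBerge m' = true ∧ ∀ c, m'.testBit c = true → P c := by
  induction cs generalizing s m with
  | nil => simp [search] at h
  | cons c cs ih =>
    change (force (m ||| 2 ^ c) (fun m' => (hasBerge m').rec (search cs s m') true) &&
      (s.rec true fun s _ => search cs s m : Bool)) = true at h
    rw [Bool.and_eq_true, force_eq] at h
    obtain ⟨h1, h2⟩ := h
    by_cases hc : P c
    · have hm' : ∀ x, (m ||| 2 ^ c).testBit x = true → P x := by
        intro x hx
        rw [Nat.testBit_or, Nat.testBit_two_pow, Bool.or_eq_true] at hx
        rcases hx with hx | hx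
        · exact hm x hx
        · exact of_decide_eq_true hx ▸ hc
      rcases hb : hasBerge (m ||| 2 ^ c) with _ | _
      · simp only [hb] at h1
        exact ih s _ h1 (by simpa [List.countP_cons, hc] using hcs) hm'
      · exact ⟨_, hb, hm'⟩
    · have hcs' : cs.countP (¬ P ·) + 1 ≤ s := by
        simpa [List.countP_cons, hc] using hcs
      cases s with
      | zero => omega
      | succ s => exact ih s m h2 (by omega) hm

/-- The quadruple consists of distinct vertices below `6`, and its covers are codes of sets
containing the respective pairs. -/
def QuadData.Valid (q : QuadData) : Prop :=
  (q.a < 6 ∧ q.b < 6 ∧ q.c < 6 ∧ q.d < 6) ∧ [q.a, q.b, q.c, q.d].Nodup ∧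
    List.Forall₂ (fun l p => ∀ c ∈ l, c.testBit p.1 = true ∧ c.testBit p.2 = true) q.covers
      [(q.a, q.b), (q.a, q.c), (q.a, q.d), (q.b, q.c), (q.b, q.d), (q.c, q.d)]

theorem valid_of_mem_quadTable : ∀ q ∈ quadTable, q.Valid := by
  unfold QuadData.Valid
  decide +kernel

section Decode

variable {V : Type*} [Fintype V]

/-- The set with code `c` under the labelling `e`. -/
def decode (e : V ≃ Fin 6) (c : ℕ) : Finset V := Finset.univ.filter fun v => c.testBit (e v)

theorem mem_decode {e : V ≃ Fin 6} {c : ℕ} {v : V} : v ∈ decode e c ↔ c.testBit (e v) = true := by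
  simp [decode]

theorem decode_injOn (e : V ≃ Fin 6) {c c' : ℕ} (hc : c < 2 ^ 6) (hc' : c' < 2 ^ 6)
    (h : decode e c = decode e c') : c = c' := by
  refine Nat.eq_of_testBit_eq fun i => ?_
  by_cases hi : i < 6
  · have := congrArg (e.symm ⟨i, hi⟩ ∈ ·) h
    simp only [mem_decode, Equiv.apply_symm_apply, eq_iff_iff] at this
    exact Bool.eq_iff_iff.2 this
  · have hp : 2 ^ 6 ≤ 2 ^ i := Nat.pow_le_pow_right (by norm_num) (by omega)
    rw [Nat.testBit_lt_two_pow (hc.trans_le hp), Nat.testBit_lt_two_pow (hc'.trans_le hp)]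

theorem card_decode (e : V ≃ Fin 6) {c : ℕ} (hc : c ∈ codes) : (decode e c).card = 3 := by
  have h : ∀ c ∈ codes, (Finset.univ.filter fun i : Fin 6 => c.testBit i).card = 3 := by
    decide +kernel
  rw [← h c hc]
  exact Finset.card_equiv e (by simp [mem_decode])

theorem countP_codes_le [DecidableEq V] (e : V ≃ Fin 6) (H : Finset (Finset V)) (hH3 : ∀ t ∈ H, t.card = 3)
    (hcard : 9 ≤ H.card) :
    codes.countP (fun c => ¬ (c < 2 ^ 6 ∧ decode e c ∈ H)) ≤ 11 := by
  have hlt : ∀ c ∈ codes, c < 2 ^ 6 := by decide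
  have hnodup : codes.Nodup := by decide
  have hsub : H ⊆ Finset.powersetCard 3 Finset.univ := fun t ht => by simp [hH3 t ht]
  have hV : Fintype.card V = 6 := by simpa using Fintype.card_congr e
  have hcompl : (Finset.powersetCard 3 Finset.univ \ H).card + H.card = 20 := by
    rw [Finset.card_sdiff_add_card_eq_card hsub, Finset.card_powersetCard, Finset.card_univ, hV]
    rfl
  have hle : (codes.filter fun c => ¬ (c < 2 ^ 6 ∧ decode e c ∈ H)).toFinset.card ≤
      (Finset.powersetCard 3 Finset.univ \ H).card := by
    refine Finset.card_le_card_of_injOn (decode e) ?_ ?_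
    · intro c hc
      have hc' := List.mem_filter.1 (List.mem_toFinset.1 hc)
      have hn : decode e c ∉ H := fun h => of_decide_eq_true hc'.2 ⟨hlt c hc'.1, h⟩
      simp [hn, card_decode e hc'.1]
    · intro c hc c' hc' h
      have h1 := List.mem_filter.1 (List.mem_toFinset.1 hc)
      have h2 := List.mem_filter.1 (List.mem_toFinset.1 hc')
      exact decode_injOn e (hlt c h1.1) (hlt c' h2.1) h
  rw [List.toFinset_card_of_nodup (hnodup.filter _), ← List.countP_eq_length_filter] at hle
  omega

theorem hasBergeK4_of_hasBerge [DecidableEq V] (e : V ≃ Fin 6) (H : Finset (Finset V)) (m : ℕ)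
    (h : hasBerge m = true) (hm : ∀ c, m.testBit c = true → c < 2 ^ 6 ∧ decode e c ∈ H) :
    HasBergeK4 H := by
  obtain ⟨q, hq, ht⟩ := exists_of_hasBerge m h
  obtain ⟨es, h1, h2, h3⟩ := exists_of_hasTransversal _ _ ht
  obtain ⟨⟨ha, hb, hc, hd⟩, hne, hcov⟩ := valid_of_mem_quadTable q hq
  generalize q.covers = ls at h1 hcov
  rcases hcov with _ | ⟨p1, _ | ⟨p2, _ | ⟨p3, _ | ⟨p4, _ | ⟨p5, _ | ⟨p6, _ | _⟩⟩⟩⟩⟩⟩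
  rcases h1 with _ | ⟨m1, _ | ⟨m2, _ | ⟨m3, _ | ⟨m4, _ | ⟨m5, _ | ⟨m6, _ | _⟩⟩⟩⟩⟩⟩
  have hsub : ∀ {c x y : ℕ} (hx : x < 6) (hy : y < 6), c.testBit x = true ∧ c.testBit y = true →
      {e.symm ⟨x, hx⟩, e.symm ⟨y, hy⟩} ⊆ decode e c := by
    intro c x y hx hy hxy v hv
    rcases Finset.mem_insert.1 hv with rfl | hv
    · simpa [mem_decode] using hxy.1
    · rw [Finset.mem_singleton.1 hv]
      simpa [mem_decode] using hxy.2
  have hnodup := h2.map_on (f := decode e) fun x hx y hy hxy =>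
    decode_injOn e (hm x (h3 x hx)).1 (hm y (h3 y hy)).1 hxy
  simp only [List.forall_mem_cons] at h3
  obtain ⟨b1, b2, b3, b4, b5, b6, -⟩ := h3
  simp only [List.nodup_cons, List.mem_cons, List.not_mem_nil, or_false, not_or] at hne
  refine ⟨e.symm ⟨q.a, ha⟩, e.symm ⟨q.b, hb⟩, e.symm ⟨q.c, hc⟩, e.symm ⟨q.d, hd⟩,
    _, _, _, _, _, _,
    ?_, ?_, ?_, ?_, ?_, ?_, hnodup, (hm _ b1).2, (hm _ b2).2, (hm _ b3).2, (hm _ b4).2,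
    (hm _ b5).2, (hm _ b6).2, hsub ha hb (p1 _ m1), hsub ha hc (p2 _ m2), hsub ha hd (p3 _ m3),
    hsub hb hc (p4 _ m4), hsub hb hd (p5 _ m5), hsub hc hd (p6 _ m6)⟩ <;>
  simp [hne]

end Decode

theorem exists_two_triples_sharing_pair {V : Type*} [DecidableEq V] [Fintype V]
    (hV : Fintype.card V = 6) (H : Finset (Finset V)) (hH3 : ∀ t ∈ H, t.card = 3)
    (hcard : 9 ≤ H.card) :
    ∃ a b c d : V, [a, b, c, d].Nodup ∧ {a, b, c} ∈ H ∧ {a, b, d} ∈ H := by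
  have hlt : (Finset.powersetCard 2 (Finset.univ : Finset V)).card <
      (H.sigma fun t => Finset.powersetCard 2 t).card := by
    rw [Finset.card_sigma, Finset.sum_congr rfl fun t ht => by
      rw [Finset.card_powersetCard, hH3 t ht], Finset.card_powersetCard, Finset.card_univ, hV,
      Finset.sum_const, smul_eq_mul, show Nat.choose 6 2 = 15 from rfl,
      show Nat.choose 3 2 = 3 from rfl]
    omega
  obtain ⟨⟨t, s⟩, hts, ⟨t', s'⟩, hts', hne, rfl⟩ :=
    Finset.exists_ne_map_eq_of_card_lt_of_maps_to hlt (f := fun x => x.2) fun x hx => by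
      have := (Finset.mem_sigma.1 hx).2
      simp_all
  simp only [Finset.mem_sigma, Finset.mem_powersetCard] at hts hts'
  obtain ⟨ht, hst, hs⟩ := hts
  obtain ⟨ht', hst', -⟩ := hts'
  obtain ⟨a, b, hab, rfl⟩ := Finset.card_eq_two.1 hs
  have hext : ∀ t ∈ H, {a, b} ⊆ t → ∃ c, c ≠ a ∧ c ≠ b ∧ t = {a, b, c} := by
    intro t ht hst
    have h1 : (t \ {a, b}).card = 1 := by
      rw [Finset.card_sdiff_of_subset hst, hH3 t ht, hs]
    obtain ⟨c, hc⟩ := Finset.card_eq_one.1 h1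
    have hmem : c ∈ t \ {a, b} := by simp [hc]
    simp only [Finset.mem_sdiff, Finset.mem_insert, Finset.mem_singleton, not_or] at hmem
    refine ⟨c, hmem.2.1, hmem.2.2, ?_⟩
    rw [← Finset.union_sdiff_of_subset hst, hc]
    ext
    simp
  obtain ⟨c, hca, hcb, rfl⟩ := hext t ht hst
  obtain ⟨d, hda, hdb, rfl⟩ := hext t' ht' hst'
  have hcd : c ≠ d := by
    rintro rfl
    exact hne rfl
  exact ⟨a, b, c, d, by simp [hab, hca.symm, hcb.symm, hda.symm, hdb.symm, hcd], ht, ht'⟩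

theorem exists_labelling {V : Type*} [DecidableEq V] [Fintype V] (hV : Fintype.card V = 6)
    {a b c d : V} (h : [a, b, c, d].Nodup) :
    ∃ e : V ≃ Fin 6, e a = 0 ∧ e b = 1 ∧ e c = 2 ∧ e d = 3 := by
  simp only [List.nodup_cons, List.mem_cons, List.not_mem_nil, or_false, not_or] at h
  obtain ⟨g, hg⟩ := Finset.exists_equiv_extend_of_card_eq (α := Fin 6) (β := V)
    (t := Finset.univ) (by simp [hV]) (s := {0, 1, 2, 3}) (f := ![a, b, c, d, a, a])
    (Finset.subset_univ _) (by
      intro x hx y hy hxy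
      fin_cases x <;> fin_cases y <;> simp_all)
  refine ⟨(g.trans (Equiv.subtypeUnivEquiv Finset.mem_univ)).symm, ?_, ?_, ?_, ?_⟩ <;>
    rw [Equiv.symm_apply_eq] <;> symm
  · exact hg 0 (by simp)
  · exact hg 1 (by simp)
  · exact hg 2 (by simp)
  · exact hg 3 (by simp)

end BergeSearch

open BergeSearch

/-- Every triple system on a 6-element vertex set with at
least `9` triples contains a Berge-`K₄`. -/
theorem bergeK4_of_nine_triples_on_six
    (V : Type*) [DecidableEq V] [Fintype V] (hV : Fintype.card V = 6)
    (H : Finset (Finset V)) (hH3 : ∀ t ∈ H, t.card = 3)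
    (hcard : 9 ≤ H.card) :
    HasBergeK4 H := by
  obtain ⟨a, b, c, d, hne, h1, h2⟩ := exists_two_triples_sharing_pair hV H hH3 hcard
  obtain ⟨e, ha, hb, hc, hd⟩ := exists_labelling hV hne
  have hdec : ∀ {n : ℕ} {x y z : V},
      (∀ i : Fin 6, n.testBit i = true ↔ i = e x ∨ i = e y ∨ i = e z) →
      decode e n = {x, y, z} := by
    intro n x y z h
    ext v
    rw [mem_decode, h]
    simp
  have h7 : decode e 7 = {a, b, c} := hdec (by rw [ha, hb, hc]; decide)
  have h11 : decode e 11 = {a, b, d} := hdec (by rw [ha, hb, hd]; decide)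
  obtain ⟨m, hm, hmH⟩ := exists_of_search (fun c => c < 2 ^ 6 ∧ decode e c ∈ H) codes 11 _
    search_codes (countP_codes_le e H hH3 hcard) (by
      intro c hc
      rw [show 2 ^ 7 + 2 ^ 11 = 2 ^ 7 ||| 2 ^ 11 from rfl, Nat.testBit_or, Nat.testBit_two_pow,
        Nat.testBit_two_pow, Bool.or_eq_true, decide_eq_true_iff, decide_eq_true_iff] at hc
      rcases hc with rfl | rfl
      · exact ⟨by norm_num, h7 ▸ h1⟩
      · exact ⟨by norm_num, h11 ▸ h2⟩)
  exact hasBergeK4_of_hasBerge e H m hm hmH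
end

section
/- Let n ≥ 6 and let H be a triple system on an n-element vertex set with at least f(n) + 1 triples in which every vertex has degree at least f(n) − f(n−1) + 1, where f(m) = ⌊m/3⌋·⌊(m+1)/3⌋·⌊(m+2)/3⌋. Then H contains either a K_4^3 − e (three triples contained in a set of four vertices) or a tight path (five distinct vertices a, b, c, d, e with {a,b,c}, {b,c,d}, {c,d,e} ∈ H). -/
/-- `p` is a subset of `t` which lies in no other member of `H`. -/
def IsPrivateSubset {V : Type*} (H : Finset (Finset V)) (t p : Finset V) : Prop :=
  p ⊆ t ∧ ∀ s ∈ H, p ⊆ s → s = t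

lemma exists_eq_insert_of_not_isPrivateSubset {V : Type*} [DecidableEq V]
    {H : Finset (Finset V)} (hH3 : ∀ t ∈ H, t.card = 3) {x y z : V} (hxy : x ≠ y)
    (h : ¬ IsPrivateSubset H {x, y, z} {x, y}) :
    ∃ u, u ≠ x ∧ u ≠ y ∧ u ≠ z ∧ ({x, y, u} : Finset V) ∈ H := by
  have hsub : ({x, y} : Finset V) ⊆ {x, y, z} := by
    intro a
    simp only [Finset.mem_insert, Finset.mem_singleton]
    tauto
  simp only [IsPrivateSubset, hsub, true_and, not_forall] at h
  obtain ⟨s, hs, hps, hne⟩ := h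
  obtain ⟨u, hu⟩ : ∃ u, s \ {x, y} = {u} := by
    rw [← Finset.card_eq_one, Finset.card_sdiff_of_subset hps, hH3 s hs, Finset.card_pair hxy]
  have hmem : u ∈ s \ {x, y} := by simp [hu]
  simp only [Finset.mem_sdiff, Finset.mem_insert, Finset.mem_singleton, not_or] at hmem
  have hs_eq : s = {x, y, u} := by
    rw [← Finset.union_sdiff_of_subset hps, hu]
    ext a
    simp
  refine ⟨u, hmem.2.1, hmem.2.2, ?_, hs_eq ▸ hs⟩
  rintro rfl
  exact hne hs_eq

lemma k43e_or_tight_path_of_not_isPrivateSubset {V : Type*} [DecidableEq V]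
    {H : Finset (Finset V)} (hH3 : ∀ t ∈ H, t.card = 3) {x y z : V}
    (hxy : x ≠ y) (hxz : x ≠ z) (hyz : y ≠ z) (ht : ({x, y, z} : Finset V) ∈ H)
    (h₁ : ¬ IsPrivateSubset H {x, y, z} {x, y}) (h₂ : ¬ IsPrivateSubset H {x, y, z} {y, z}) :
    (∃ S : Finset V, S.card = 4 ∧ 3 ≤ (H.filter (fun t => t ⊆ S)).card) ∨
    (∃ a b c d e : V, ([a, b, c, d, e] : List V).Nodup ∧
      ({a, b, c} : Finset V) ∈ H ∧ ({b, c, d} : Finset V) ∈ H ∧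
      ({c, d, e} : Finset V) ∈ H) := by
  obtain ⟨u, hux, huy, huz, hu⟩ := exists_eq_insert_of_not_isPrivateSubset hH3 hxy h₁
  have hrot : ({x, y, z} : Finset V) = {y, z, x} := by
    ext a
    simp only [Finset.mem_insert, Finset.mem_singleton]
    tauto
  rw [hrot] at h₂
  obtain ⟨w, hwy, hwz, hwx, hw⟩ := exists_eq_insert_of_not_isPrivateSubset hH3 hyz h₂
  by_cases huw : u = w
  · subst huw
    refine Or.inl ⟨{x, y, z, u}, by
      simp [hxy, hxz, hyz, hux.symm, huy.symm, huz.symm], ?_⟩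
    have hcard : ({{x, y, z}, {x, y, u}, {y, z, u}} : Finset (Finset V)).card = 3 := by
      refine Finset.card_eq_three.mpr ⟨_, _, _, ?_, ?_, ?_, rfl⟩
      · exact fun h => absurd (h ▸ by simp : z ∈ ({x, y, u} : Finset V)) (by grind)
      · exact fun h => absurd (h ▸ by simp : x ∈ ({y, z, u} : Finset V)) (by grind)
      · exact fun h => absurd (h ▸ by simp : x ∈ ({y, z, u} : Finset V)) (by grind)
    rw [← hcard]
    apply Finset.card_le_card
    intro s hs
    simp only [Finset.mem_insert, Finset.mem_singleton] at hs
    rw [Finset.mem_filter]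
    rcases hs with rfl | rfl | rfl
    · exact ⟨ht, by grind⟩
    · exact ⟨hu, by grind⟩
    · exact ⟨hw, by grind⟩
  · refine Or.inr ⟨u, x, y, z, w, ?_, ?_, ht, hw⟩
    · simp only [List.nodup_cons, List.mem_cons, List.not_mem_nil, or_false, not_or]
      grind
    · convert hu using 1
      ext a
      simp only [Finset.mem_insert, Finset.mem_singleton]
      tauto

lemma two_mul_card_le_choose_two {V : Type*} [DecidableEq V] [Fintype V]
    {H : Finset (Finset V)} (hH3 : ∀ t ∈ H, t.card = 3)
    (hfree : ¬ ((∃ S : Finset V, S.card = 4 ∧ 3 ≤ (H.filter (fun t => t ⊆ S)).card) ∨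
      (∃ a b c d e : V, ([a, b, c, d, e] : List V).Nodup ∧
        ({a, b, c} : Finset V) ∈ H ∧ ({b, c, d} : Finset V) ∈ H ∧
        ({c, d, e} : Finset V) ∈ H))) :
    H.card * 2 ≤ (Fintype.card V).choose 2 := by
  classical
  have key := Finset.card_mul_le_card_mul (s := H) (t := Finset.univ.powersetCard 2)
    (m := 2) (n := 1) (IsPrivateSubset H) ?_ ?_
  · simpa [Finset.card_powersetCard] using key
  · intro t ht
    obtain ⟨x, y, z, hxy, hxz, hyz, rfl⟩ := Finset.card_eq_three.mp (hH3 t ht)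
    have e₁ : ({x, y, z} : Finset V) = {y, x, z} := by grind
    have e₂ : ({x, y, z} : Finset V) = {x, z, y} := by grind
    have key {p q : Finset V} (hpq : p ≠ q) (hp : p.card = 2) (hq : q.card = 2)
        (hp' : IsPrivateSubset H {x, y, z} p) (hq' : IsPrivateSubset H {x, y, z} q) :
        2 ≤ (Finset.bipartiteAbove (IsPrivateSubset H) (Finset.univ.powersetCard 2)
          {x, y, z}).card := by
      refine (Finset.card_pair hpq).ge.trans (Finset.card_le_card ?_)
      simp [Finset.insert_subset_iff, Finset.mem_bipartiteAbove, Finset.mem_powersetCard,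
        hp, hq, hp', hq']
    have h₁ : IsPrivateSubset H {x, y, z} {x, y} ∨ IsPrivateSubset H {x, y, z} {y, z} := by
      by_contra! h
      exact hfree (k43e_or_tight_path_of_not_isPrivateSubset hH3 hxy hxz hyz ht h.1 h.2)
    have h₂ : IsPrivateSubset H {x, y, z} {x, y} ∨ IsPrivateSubset H {x, y, z} {x, z} := by
      by_contra! h
      rw [Finset.pair_comm x y, e₁] at h
      exact hfree (k43e_or_tight_path_of_not_isPrivateSubset hH3 hxy.symm hyz hxz
        (e₁ ▸ ht) h.1 h.2)
    have h₃ : IsPrivateSubset H {x, y, z} {x, z} ∨ IsPrivateSubset H {x, y, z} {y, z} := by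
      by_contra! h
      rw [e₂, Finset.pair_comm y z] at h
      exact hfree (k43e_or_tight_path_of_not_isPrivateSubset hH3 hxz hxy hyz.symm
        (e₂ ▸ ht) h.1 h.2)
    have n₁ : ({x, y} : Finset V) ≠ {y, z} := fun h => by
      have : x ∈ ({y, z} : Finset V) := h ▸ by simp
      grind
    have n₂ : ({x, y} : Finset V) ≠ {x, z} := fun h => by
      have : y ∈ ({x, z} : Finset V) := h ▸ by simp
      grind
    have n₃ : ({x, z} : Finset V) ≠ {y, z} := fun h => by
      have : x ∈ ({y, z} : Finset V) := h ▸ by simp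
      grind
    have c₁ := Finset.card_pair hxy
    have c₂ := Finset.card_pair hxz
    have c₃ := Finset.card_pair hyz
    rcases h₁ with h | h
    · rcases h₃ with h' | h'
      · exact key n₂ c₁ c₂ h h'
      · exact key n₁ c₁ c₃ h h'
    · rcases h₂ with h' | h'
      · exact key n₁ c₁ c₃ h' h
      · exact key n₃ c₂ c₃ h' h
  · intro p _
    rw [Finset.card_le_one]
    intro s hs t ht
    rw [Finset.mem_bipartiteBelow] at hs ht
    exact ht.2.2 s hs.1 hs.2.1

lemma choose_two_lt_two_mul_tripartite {n : ℕ} (hn : 6 ≤ n) :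
    n.choose 2 < (n / 3 * ((n + 1) / 3) * ((n + 2) / 3) + 1) * 2 := by
  rw [Nat.choose_two_right]
  apply Nat.div_lt_of_lt_mul
  obtain ⟨k, rfl | rfl | rfl⟩ : ∃ k, n = 3 * (k + 2) ∨ n = 3 * (k + 2) + 1 ∨
      n = 3 * (k + 2) + 2 := ⟨n / 3 - 2, by omega⟩
  · rw [show 3 * (k + 2) / 3 = k + 2 by omega, show (3 * (k + 2) + 1) / 3 = k + 2 by omega,
      show (3 * (k + 2) + 2) / 3 = k + 2 by omega, show 3 * (k + 2) - 1 = 3 * k + 5 by omega]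
    nlinarith [Nat.zero_le (k ^ 3), Nat.zero_le (k ^ 2)]
  · rw [show (3 * (k + 2) + 1) / 3 = k + 2 by omega,
      show (3 * (k + 2) + 1 + 1) / 3 = k + 2 by omega,
      show (3 * (k + 2) + 1 + 2) / 3 = k + 3 by omega, Nat.add_sub_cancel]
    nlinarith [Nat.zero_le (k ^ 3), Nat.zero_le (k ^ 2)]
  · rw [show (3 * (k + 2) + 2) / 3 = k + 2 by omega,
      show (3 * (k + 2) + 2 + 1) / 3 = k + 3 by omega,
      show (3 * (k + 2) + 2 + 2) / 3 = k + 3 by omega,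
      show 3 * (k + 2) + 2 - 1 = 3 * k + 7 by omega]
    nlinarith [Nat.zero_le (k ^ 3), Nat.zero_le (k ^ 2)]


/-- If `n ≥ 6` and `H` is a triple system on an `n`-element
vertex set with at least `f n + 1` triples in which every vertex has degree at
least `f n - f (n-1) + 1` (where `f m = ⌊m/3⌋ * ⌊(m+1)/3⌋ * ⌊(m+2)/3⌋`), then
`H` contains a `K₄³ - e` (four vertices spanning at least three triples) or a
tight path. -/
theorem k43e_or_tight_path (n : ℕ) (hn : 6 ≤ n)
    (V : Type*) [DecidableEq V] [Fintype V] (hV : Fintype.card V = n)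
    (H : Finset (Finset V)) (hH3 : ∀ t ∈ H, t.card = 3)
    (hcard : n / 3 * ((n + 1) / 3) * ((n + 2) / 3) + 1 ≤ H.card)
    (hdeg : ∀ v : V,
      n / 3 * ((n + 1) / 3) * ((n + 2) / 3)
        - (n - 1) / 3 * (n / 3) * ((n + 1) / 3) + 1
        ≤ (H.filter (fun t => v ∈ t)).card) :
    (∃ S : Finset V, S.card = 4 ∧ 3 ≤ (H.filter (fun t => t ⊆ S)).card) ∨
    (∃ a b c d e : V, ([a, b, c, d, e] : List V).Nodup ∧
      ({a, b, c} : Finset V) ∈ H ∧ ({b, c, d} : Finset V) ∈ H ∧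
      ({c, d, e} : Finset V) ∈ H) := by
  by_contra hfree
  have hle := two_mul_card_le_choose_two hH3 hfree
  have hlt := choose_two_lt_two_mul_tripartite hn
  rw [hV] at hle
  omega
end

section
/- Let H be a Berge-K4-free triple system containing three pairwise distinct triples t0 = {a, b, c}, t1 with {a, b} ⊆ t1, and t2 with {b, c} ⊆ t2, where a, b, c are distinct vertices. Let z be a vertex lying in none of t0, t1, t2. Then there do not exist three pairwise distinct triples f1, f2, f3 ∈ H, each containing z, together with pairwise distinct vertices a1, a2, a3 such that a_i ∈ f_i ∩ {a, b, c} for i = 1, 2, 3 (i.e., the label sets f_i ∩ {a,b,c} admit no system of distinct representatives). -/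
/-- Given a Berge-triangle `t₀ = {a,b,c}`, `t₁ ⊇ {a,b}`,
`t₂ ⊇ {b,c}` in a Berge-`K₄`-free triple system `H` and a vertex `z` outside
`t₀ ∪ t₁ ∪ t₂`, there are no three pairwise distinct triples of `H` through `z`
whose label sets `fᵢ ∩ {a,b,c}` admit a system of distinct representatives. -/
theorem no_distinct_representatives
    (V : Type*) [DecidableEq V]
    (H : Finset (Finset V)) (hH3 : ∀ t ∈ H, t.card = 3)
    (hfree : ¬ HasBergeK4 H)
    (a b c : V) (hab : a ≠ b) (hac : a ≠ c) (hbc : b ≠ c)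
    (t₀ t₁ t₂ : Finset V) (ht₀ : t₀ ∈ H) (ht₁ : t₁ ∈ H) (ht₂ : t₂ ∈ H)
    (ht₀eq : t₀ = {a, b, c}) (h01 : t₀ ≠ t₁) (h02 : t₀ ≠ t₂) (h12 : t₁ ≠ t₂)
    (habt₁ : ({a, b} : Finset V) ⊆ t₁) (hbct₂ : ({b, c} : Finset V) ⊆ t₂)
    (z : V) (hz₀ : z ∉ t₀) (hz₁ : z ∉ t₁) (hz₂ : z ∉ t₂) :
    ¬ ∃ (f₁ f₂ f₃ : Finset V) (a₁ a₂ a₃ : V),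
        f₁ ∈ H ∧ f₂ ∈ H ∧ f₃ ∈ H ∧
        f₁ ≠ f₂ ∧ f₁ ≠ f₃ ∧ f₂ ≠ f₃ ∧
        z ∈ f₁ ∧ z ∈ f₂ ∧ z ∈ f₃ ∧
        a₁ ≠ a₂ ∧ a₁ ≠ a₃ ∧ a₂ ≠ a₃ ∧
        a₁ ∈ f₁ ∩ ({a, b, c} : Finset V) ∧
        a₂ ∈ f₂ ∩ ({a, b, c} : Finset V) ∧
        a₃ ∈ f₃ ∩ ({a, b, c} : Finset V) := by
  rintro ⟨f₁, f₂, f₃, a₁, a₂, a₃, hf₁, hf₂, hf₃, hf₁₂, hf₁₃, hf₂₃, hz₁', hz₂', hz₃',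
    ha₁₂, ha₁₃, ha₂₃, ha₁, ha₂, ha₃⟩
  have key : ∀ g₁ g₂ g₃ : Finset V, g₁ ∈ H → g₂ ∈ H → g₃ ∈ H → g₁ ≠ g₂ → g₁ ≠ g₃ → g₂ ≠ g₃ →
      z ∈ g₁ → z ∈ g₂ → z ∈ g₃ → a ∈ g₁ → b ∈ g₂ → c ∈ g₃ → False := by
    intro g₁ g₂ g₃ hg₁ hg₂ hg₃ hg₁₂ hg₁₃ hg₂₃ hzg₁ hzg₂ hzg₃ hag hbg hcg
    have ne_of_mem : ∀ {t g : Finset V}, z ∉ t → z ∈ g → t ≠ g := fun ht hg h => ht (h ▸ hg)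
    refine hfree ⟨a, b, c, z, t₁, t₀, g₁, t₂, g₂, g₃, hab, hac, ?_, hbc, ?_, ?_, ?_,
      ht₁, ht₀, hg₁, ht₂, hg₂, hg₃, habt₁, ?_, ?_, hbct₂, ?_, ?_⟩
    · rintro rfl; simp [ht₀eq] at hz₀
    · rintro rfl; simp [ht₀eq] at hz₀
    · rintro rfl; simp [ht₀eq] at hz₀
    · simp [h01.symm, h12, h02, hg₁₂, hg₁₃, hg₂₃, ne_of_mem hz₀ hzg₁, ne_of_mem hz₀ hzg₂,
        ne_of_mem hz₀ hzg₃, ne_of_mem hz₁ hzg₁, ne_of_mem hz₁ hzg₂, ne_of_mem hz₁ hzg₃,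
        (ne_of_mem hz₂ hzg₁).symm, ne_of_mem hz₂ hzg₂, ne_of_mem hz₂ hzg₃]
    all_goals simp [Finset.insert_subset_iff, *]
  simp only [Finset.mem_inter, Finset.mem_insert, Finset.mem_singleton] at ha₁ ha₂ ha₃
  grind
end

section
/- Let H be a Berge-K4-free triple system containing three pairwise distinct triples t0 = {a, b, c}, t1 with {a, b} ⊆ t1, and t2 with {b, c} ⊆ t2, where a, b, c are distinct vertices, and let Z be the set of vertices lying in none of t0, t1, t2. Then for every v ∈ Z there are at most two triples g ∈ H with v ∈ g and |g ∩ {a, b, c}| = 2 (loops in the trace on {a,b,c} have multiplicity at most two). -/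
/-- In the trace on `{a,b,c}` of a Berge-`K₄`-free triple
system with a Berge-triangle `t₀, t₁, t₂`, every vertex of `Z` carries at most
two loops: at most two triples `g ∈ H` with `v ∈ g` and `|g ∩ {a,b,c}| = 2`. -/
theorem loops_multiplicity_le_two
    (V : Type*) [DecidableEq V]
    (H : Finset (Finset V)) (hH3 : ∀ t ∈ H, t.card = 3)
    (hfree : ¬ HasBergeK4 H)
    (a b c : V) (hab : a ≠ b) (hac : a ≠ c) (hbc : b ≠ c)
    (t₀ t₁ t₂ : Finset V) (ht₀ : t₀ ∈ H) (ht₁ : t₁ ∈ H) (ht₂ : t₂ ∈ H)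
    (ht₀eq : t₀ = {a, b, c}) (h01 : t₀ ≠ t₁) (h02 : t₀ ≠ t₂) (h12 : t₁ ≠ t₂)
    (habt₁ : ({a, b} : Finset V) ⊆ t₁) (hbct₂ : ({b, c} : Finset V) ⊆ t₂)
    (v : V) (hv₀ : v ∉ t₀) (hv₁ : v ∉ t₁) (hv₂ : v ∉ t₂) :
    (H.filter (fun g => v ∈ g ∧ (g ∩ ({a, b, c} : Finset V)).card = 2)).card
      ≤ 2 := by
  have hsub : H.filter (fun g => v ∈ g ∧ (g ∩ ({a, b, c} : Finset V)).card = 2) ⊆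
      {{v, a, c}, {v, a, b}, {v, b, c}} := by
    intro g hg
    obtain ⟨hgH, hvg, hg2⟩ := Finset.mem_filter.1 hg
    have hvabc : v ∉ g ∩ ({a, b, c} : Finset V) := fun h =>
      hv₀ (ht₀eq ▸ (Finset.mem_inter.1 h).2)
    have hgeq : insert v (g ∩ ({a, b, c} : Finset V)) = g := by
      refine Finset.eq_of_subset_of_card_le
        (Finset.insert_subset hvg Finset.inter_subset_left) ?_
      rw [Finset.card_insert_of_notMem hvabc, hg2, hH3 g hgH]
    rw [← hgeq]
    by_cases ha : a ∈ g <;> by_cases hb : b ∈ g <;> by_cases hc : c ∈ g <;>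
      simp_all [Finset.inter_insert_of_mem, Finset.inter_insert_of_notMem]
  by_contra! hcard
  have heq := Finset.eq_of_subset_of_card_le hsub (Finset.card_le_three.trans hcard)
  have hmem : ∀ g ∈ ({{v, a, c}, {v, a, b}, {v, b, c}} : Finset (Finset V)), g ∈ H :=
    fun g hg => Finset.mem_of_mem_filter g (heq ▸ hg)
  have hne : ∀ {s t : Finset V}, v ∈ s → v ∉ t → t ≠ s := fun hs ht h => ht (h ▸ hs)
  have hne' : ∀ {s t : Finset V} (x : V), x ∈ s → x ∉ t → s ≠ t := fun x hs ht h => ht (h ▸ hs)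
  have hv : v ≠ a ∧ v ≠ b ∧ v ≠ c := by simpa [ht₀eq] using hv₀
  obtain ⟨hva, hvb, hvc⟩ := hv
  refine hfree ⟨a, b, c, v, t₁, t₀, {v, a, c}, t₂, {v, a, b}, {v, b, c},
    hab, hac, hva.symm, hbc, hvb.symm, hvc.symm, ?_, ht₁, ht₀, hmem _ (by simp), ht₂,
    hmem _ (by simp), hmem _ (by simp), habt₁, ?_, ?_, hbct₂, ?_, ?_⟩
  · have h₁ : ({v, a, c} : Finset V) ≠ {v, a, b} := hne' c (by simp) (by simp [*, Ne.symm])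
    have h₂ : ({v, a, c} : Finset V) ≠ {v, b, c} := hne' a (by simp) (by simp [*, Ne.symm])
    have h₃ : ({v, a, b} : Finset V) ≠ {v, b, c} := hne' a (by simp) (by simp [*, Ne.symm])
    have hnot : ∀ {t : Finset V} (x y : V), v ∉ t → t ≠ {v, x, y} := fun x y h =>
      hne (by simp) h
    simp only [List.nodup_cons, List.mem_cons, List.not_mem_nil, or_false, not_or,
      not_false_eq_true, List.nodup_nil, and_true]
    exact ⟨⟨h01.symm, hnot _ _ hv₁, h12, hnot _ _ hv₁, hnot _ _ hv₁⟩,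
      ⟨hnot _ _ hv₀, h02, hnot _ _ hv₀, hnot _ _ hv₀⟩,
      ⟨(hnot _ _ hv₂).symm, h₁, h₂⟩, ⟨hnot _ _ hv₂, hnot _ _ hv₂⟩, h₃⟩
  all_goals simp [Finset.insert_subset_iff, ht₀eq]
end

section
/- Let H be a Berge-K4-free triple system containing three pairwise distinct triples t0 = {a, b, c}, t1 with {a, b} ⊆ t1, and t2 with {b, c} ⊆ t2, where a, b, c are distinct vertices, and let Z be the set of vertices lying in none of t0, t1, t2. Then for all distinct u, v ∈ Z there are at most two triples g ∈ H with {u, v} ⊆ g and |g ∩ {a, b, c}| = 1 (non-loop edges of the trace on {a,b,c} between vertices of Z have multiplicity at most two). -/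
/-- In the trace on `{a,b,c}` of a Berge-`K₄`-free triple
system with a Berge-triangle `t₀, t₁, t₂`, every non-loop edge between two
vertices of `Z` has multiplicity at most two: for distinct `u, v ∈ Z` there are
at most two triples `g ∈ H` with `{u, v} ⊆ g` and `|g ∩ {a,b,c}| = 1`. -/
theorem edges_multiplicity_le_two
    (V : Type*) [DecidableEq V]
    (H : Finset (Finset V)) (hH3 : ∀ t ∈ H, t.card = 3)
    (hfree : ¬ HasBergeK4 H)
    (a b c : V) (hab : a ≠ b) (hac : a ≠ c) (hbc : b ≠ c)
    (t₀ t₁ t₂ : Finset V) (ht₀ : t₀ ∈ H) (ht₁ : t₁ ∈ H) (ht₂ : t₂ ∈ H)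
    (ht₀eq : t₀ = {a, b, c}) (h01 : t₀ ≠ t₁) (h02 : t₀ ≠ t₂) (h12 : t₁ ≠ t₂)
    (habt₁ : ({a, b} : Finset V) ⊆ t₁) (hbct₂ : ({b, c} : Finset V) ⊆ t₂)
    (u v : V) (huv : u ≠ v)
    (hu₀ : u ∉ t₀) (hu₁ : u ∉ t₁) (hu₂ : u ∉ t₂)
    (hv₀ : v ∉ t₀) (hv₁ : v ∉ t₁) (hv₂ : v ∉ t₂) :
    (H.filter (fun g => ({u, v} : Finset V) ⊆ g ∧
      (g ∩ ({a, b, c} : Finset V)).card = 1)).card ≤ 2 := by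
  have mem_of_mem_filter : ∀ g ∈ H.filter (fun g => ({u, v} : Finset V) ⊆ g ∧
      (g ∩ ({a, b, c} : Finset V)).card = 1),
      g ∈ H ∧ (g = {u, v, a} ∨ g = {u, v, b} ∨ g = {u, v, c}) := by
    intro g hg
    obtain ⟨hgH, huvg, hcard⟩ := Finset.mem_filter.mp hg
    refine ⟨hgH, ?_⟩
    obtain ⟨x, hx⟩ := Finset.card_pos.mp (by omega : 0 < (g ∩ ({a, b, c} : Finset V)).card)
    obtain ⟨hxg, hxabc⟩ := Finset.mem_inter.mp hx
    have hxu : u ≠ x := by rintro rfl; exact hu₀ (ht₀eq ▸ hxabc)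
    have hxv : v ≠ x := by rintro rfl; exact hv₀ (ht₀eq ▸ hxabc)
    have hsub : ({u, v, x} : Finset V) ⊆ g := by
      intro y hy
      simp only [Finset.mem_insert, Finset.mem_singleton] at hy
      rcases hy with rfl | rfl | rfl
      · exact huvg (by simp)
      · exact huvg (by simp)
      · exact hxg
    have hg_eq : ({u, v, x} : Finset V) = g := Finset.eq_of_subset_of_card_le hsub (by
      rw [hH3 g hgH, Finset.card_eq_three.mpr ⟨u, v, x, huv, hxu, hxv, rfl⟩])
    simp only [Finset.mem_insert, Finset.mem_singleton] at hxabc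
    rcases hxabc with rfl | rfl | rfl <;> simp [← hg_eq]
  by_contra hlarge
  have not_subset_pair : ∀ p q : Finset V, ¬ (H.filter (fun g => ({u, v} : Finset V) ⊆ g ∧
      (g ∩ ({a, b, c} : Finset V)).card = 1)) ⊆ {p, q} := fun p q hpq =>
    hlarge ((Finset.card_le_card hpq).trans Finset.card_le_two)
  have ha : ({u, v, a} : Finset V) ∈ H := by
    by_contra hnot
    refine not_subset_pair {u, v, b} {u, v, c} fun g hg => ?_
    obtain ⟨hgH, rfl | rfl | rfl⟩ := mem_of_mem_filter g hg
    · exact absurd hgH hnot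
    · simp
    · simp
  have hb : ({u, v, b} : Finset V) ∈ H := by
    by_contra hnot
    refine not_subset_pair {u, v, a} {u, v, c} fun g hg => ?_
    obtain ⟨hgH, rfl | rfl | rfl⟩ := mem_of_mem_filter g hg
    · simp
    · exact absurd hgH hnot
    · simp
  have hc : ({u, v, c} : Finset V) ∈ H := by
    by_contra hnot
    refine not_subset_pair {u, v, a} {u, v, b} fun g hg => ?_
    obtain ⟨hgH, rfl | rfl | rfl⟩ := mem_of_mem_filter g hg
    · simp
    · simp
    · exact absurd hgH hnot
  have ne_of_notMem : ∀ (t : Finset V) (x : V), u ∉ t → t ≠ {u, v, x} := by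
    rintro t x ht rfl
    simp at ht
  obtain ⟨hua, hub, huc⟩ : u ≠ a ∧ u ≠ b ∧ u ≠ c := by simpa [ht₀eq] using hu₀
  obtain ⟨hva, hvb, hvc⟩ : v ≠ a ∧ v ≠ b ∧ v ≠ c := by simpa [ht₀eq] using hv₀
  have ne_of_ne : ∀ x y : V, u ≠ x → v ≠ x → x ≠ y → ({u, v, x} : Finset V) ≠ {u, v, y} := by
    intro x y hux hvx hxy h
    have hx : x ∈ ({u, v, y} : Finset V) := h ▸ (by simp)
    simp [hux.symm, hvx.symm, hxy] at hx
  refine hfree ⟨a, b, c, u, t₁, t₀, {u, v, a}, t₂, {u, v, b}, {u, v, c},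
    hab, hac, hua.symm, hbc, hub.symm, huc.symm, ?_, ht₁, ht₀, ha, ht₂, hb, hc,
    habt₁, ?_, ?_, hbct₂, ?_, ?_⟩
  · simp only [List.nodup_cons, List.mem_cons, List.not_mem_nil, or_false, not_or,
      not_false_eq_true, List.nodup_nil, and_true]
    exact ⟨⟨h01.symm, ne_of_notMem _ _ hu₁, h12, ne_of_notMem _ _ hu₁, ne_of_notMem _ _ hu₁⟩,
      ⟨ne_of_notMem _ _ hu₀, h02, ne_of_notMem _ _ hu₀, ne_of_notMem _ _ hu₀⟩,
      ⟨(ne_of_notMem _ _ hu₂).symm, ne_of_ne a b hua hva hab, ne_of_ne a c hua hva hac⟩,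
      ⟨ne_of_notMem _ _ hu₂, ne_of_notMem _ _ hu₂⟩, ne_of_ne b c hub hvb hbc⟩
  all_goals simp [Finset.insert_subset_iff, ht₀eq]
end

section
/- Let H be a Berge-K4-free triple system containing three pairwise distinct triples t0 = {a, b, c}, t1 with {a, b} ⊆ t1, and t2 with {b, c} ⊆ t2, where a, b, c are distinct vertices, and let Z be the set of vertices lying in none of t0, t1, t2. Suppose v ∈ Z and there are two distinct triples g1, g2 ∈ H with v ∈ g_i and |g_i ∩ {a, b, c}| = 2 for i = 1, 2 (a double loop on v). Then there is no triple f ∈ H with v ∈ f and |f ∩ {a, b, c}| = 1 (a vertex of Z carrying a double loop is incident to no edge of the trace on {a,b,c}). -/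
/-- Three spokes from `v` to a Berge-triangle whose triples avoid `v` give a Berge-`K₄`. -/
theorem hasBergeK4_of_spokes {V : Type*} [DecidableEq V] {H : Finset (Finset V)}
    {a b c v : V} (hab : a ≠ b) (hac : a ≠ c) (hbc : b ≠ c)
    {r s t : Finset V} (hr : r ∈ H) (hs : s ∈ H) (ht : t ∈ H)
    (hrs : r ≠ s) (hrt : r ≠ t) (hst : s ≠ t)
    (har : a ∈ r) (hbr : b ∈ r) (has : a ∈ s) (hcs : c ∈ s) (hbt : b ∈ t) (hct : c ∈ t)
    (hvr : v ∉ r) (hvs : v ∉ s) (hvt : v ∉ t)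
    {x y z : Finset V} (hx : x ∈ H) (hy : y ∈ H) (hz : z ∈ H)
    (hxy : x ≠ y) (hxz : x ≠ z) (hyz : y ≠ z)
    (hvx : v ∈ x) (hvy : v ∈ y) (hvz : v ∈ z) (hax : a ∈ x) (hby : b ∈ y) (hcz : c ∈ z) :
    HasBergeK4 H := by
  have ne_of_mem {p q : Finset V} (hp : v ∈ p) (hq : v ∉ q) : p ≠ q := fun h => hq (h ▸ hp)
  refine ⟨v, a, b, c, x, y, z, r, s, t, ?_, ?_, ?_, hab, hac, hbc, ?_, hx, hy, hz, hr, hs, ht,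
    ?_, ?_, ?_, ?_, ?_, ?_⟩
  · rintro rfl; exact hvr har
  · rintro rfl; exact hvr hbr
  · rintro rfl; exact hvs hcs
  · simp [hxy, hxz, hyz, hrs, hrt, hst, ne_of_mem hvx hvr, ne_of_mem hvx hvs, ne_of_mem hvx hvt,
      ne_of_mem hvy hvr, ne_of_mem hvy hvs, ne_of_mem hvy hvt, ne_of_mem hvz hvr,
      ne_of_mem hvz hvs, ne_of_mem hvz hvt]
  all_goals simp [Finset.insert_subset_iff, *]

/-- A triple through `v` meeting `{a, b, c}` in two vertices consists of `v` and these two. -/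
theorem eq_of_card_inter_eq_two {V : Type*} [DecidableEq V] {a b c v : V} {g : Finset V}
    (hg : g.card = 3) (hvg : v ∈ g) (hv : v ∉ ({a, b, c} : Finset V))
    (h : (g ∩ {a, b, c}).card = 2) :
    g = {v, a, b} ∨ g = {v, a, c} ∨ g = {v, b, c} := by
  have hins : insert v (g ∩ {a, b, c}) = g := by
    apply Finset.eq_of_subset_of_card_le
    · exact Finset.insert_subset hvg Finset.inter_subset_left
    · rw [Finset.card_insert_of_notMem (fun hm => hv (Finset.mem_inter.1 hm).2), h, hg]
  obtain ⟨x, y, hxy, he⟩ := Finset.card_eq_two.1 h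
  have hx : x ∈ ({a, b, c} : Finset V) :=
    (Finset.mem_inter.1 (he ▸ Finset.mem_insert_self x {y} : x ∈ g ∩ {a, b, c})).2
  have hy : y ∈ ({a, b, c} : Finset V) :=
    (Finset.mem_inter.1 (he ▸ by simp : y ∈ g ∩ {a, b, c})).2
  rw [he] at hins
  simp only [Finset.mem_insert, Finset.mem_singleton] at hx hy
  rcases hx with rfl | rfl | rfl <;> rcases hy with rfl | rfl | rfl <;>
    first
    | exact absurd rfl hxy
    | simp [← hins, Finset.pair_comm]

/-- In the trace on `{a,b,c}` of a Berge-`K₄`-free triple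
system with a Berge-triangle `t₀, t₁, t₂`, a vertex of `Z` carrying a double
loop is incident to no edge of the trace. -/
theorem double_loop_component
    (V : Type*) [DecidableEq V]
    (H : Finset (Finset V)) (hH3 : ∀ t ∈ H, t.card = 3)
    (hfree : ¬ HasBergeK4 H)
    (a b c : V) (hab : a ≠ b) (hac : a ≠ c) (hbc : b ≠ c)
    (t₀ t₁ t₂ : Finset V) (ht₀ : t₀ ∈ H) (ht₁ : t₁ ∈ H) (ht₂ : t₂ ∈ H)
    (ht₀eq : t₀ = {a, b, c}) (h01 : t₀ ≠ t₁) (h02 : t₀ ≠ t₂) (h12 : t₁ ≠ t₂)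
    (habt₁ : ({a, b} : Finset V) ⊆ t₁) (hbct₂ : ({b, c} : Finset V) ⊆ t₂)
    (v : V) (hv₀ : v ∉ t₀) (hv₁ : v ∉ t₁) (hv₂ : v ∉ t₂)
    (g₁ g₂ : Finset V) (hg₁ : g₁ ∈ H) (hg₂ : g₂ ∈ H) (hg : g₁ ≠ g₂)
    (hvg₁ : v ∈ g₁) (hvg₂ : v ∈ g₂)
    (hl₁ : (g₁ ∩ ({a, b, c} : Finset V)).card = 2)
    (hl₂ : (g₂ ∩ ({a, b, c} : Finset V)).card = 2) :
    ¬ ∃ f ∈ H, v ∈ f ∧ (f ∩ ({a, b, c} : Finset V)).card = 1 := by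
  rintro ⟨f, hf, hvf, hf1⟩
  have ha₀ : a ∈ t₀ := by simp [ht₀eq]
  have hc₀ : c ∈ t₀ := by simp [ht₀eq]
  have hv : v ∉ ({a, b, c} : Finset V) := ht₀eq ▸ hv₀
  have hfg₁ : f ≠ g₁ := by rintro rfl; omega
  have hfg₂ : f ≠ g₂ := by rintro rfl; omega
  have spokes {x y z : Finset V} (hx : x ∈ H) (hy : y ∈ H) (hz : z ∈ H)
      (hxy : x ≠ y) (hxz : x ≠ z) (hyz : y ≠ z) (hvx : v ∈ x) (hvy : v ∈ y) (hvz : v ∈ z)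
      (hax : a ∈ x) (hby : b ∈ y) (hcz : c ∈ z) : False :=
    hfree <| hasBergeK4_of_spokes hab hac hbc ht₁ ht₀ ht₂ h01.symm h12 h02
      (habt₁ (by simp)) (habt₁ (by simp)) ha₀ hc₀ (hbct₂ (by simp)) (hbct₂ (by simp))
      hv₁ hv₀ hv₂ hx hy hz hxy hxz hyz hvx hvy hvz hax hby hcz
  obtain ⟨x, hx⟩ := Finset.card_pos.1 (hf1 ▸ Nat.one_pos)
  obtain ⟨hxf, hx⟩ := Finset.mem_inter.1 hx
  simp only [Finset.mem_insert, Finset.mem_singleton] at hx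
  have hmem₁ := eq_of_card_inter_eq_two (hH3 g₁ hg₁) hvg₁ hv hl₁
  have hmem₂ := eq_of_card_inter_eq_two (hH3 g₂ hg₂) hvg₂ hv hl₂
  have hgs : (b ∈ g₁ ∧ c ∈ g₂ ∨ b ∈ g₂ ∧ c ∈ g₁) ∧ (a ∈ g₁ ∧ c ∈ g₂ ∨ a ∈ g₂ ∧ c ∈ g₁) ∧
      (a ∈ g₁ ∧ b ∈ g₂ ∨ a ∈ g₂ ∧ b ∈ g₁) := by
    rcases hmem₁ with h₁ | h₁ | h₁ <;> rcases hmem₂ with h₂ | h₂ | h₂ <;>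
      first
      | exact absurd (h₁.trans h₂.symm) hg
      | simp [h₁, h₂]
  obtain ⟨hbcg, hacg, habg⟩ := hgs
  rcases hx with rfl | rfl | rfl
  · rcases hbcg with ⟨h₁, h₂⟩ | ⟨h₂, h₁⟩
    · exact spokes hf hg₁ hg₂ hfg₁ hfg₂ hg hvf hvg₁ hvg₂ hxf h₁ h₂
    · exact spokes hf hg₂ hg₁ hfg₂ hfg₁ hg.symm hvf hvg₂ hvg₁ hxf h₂ h₁
  · rcases hacg with ⟨h₁, h₂⟩ | ⟨h₂, h₁⟩
    · exact spokes hg₁ hf hg₂ hfg₁.symm hg hfg₂ hvg₁ hvf hvg₂ h₁ hxf h₂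
    · exact spokes hg₂ hf hg₁ hfg₂.symm hg.symm hfg₁ hvg₂ hvf hvg₁ h₂ hxf h₁
  · rcases habg with ⟨h₁, h₂⟩ | ⟨h₂, h₁⟩
    · exact spokes hg₁ hg₂ hf hg hfg₁.symm hfg₂.symm hvg₁ hvg₂ hvf h₁ h₂ hxf
    · exact spokes hg₂ hg₁ hf hg.symm hfg₂.symm hfg₁.symm hvg₂ hvg₁ hvf h₂ h₁ hxf
end

section
/- Let H be a Berge-K4-free triple system containing three pairwise distinct triples t0 = {a, b, c}, t1 with {a, b} ⊆ t1, and t2 with {b, c} ⊆ t2, where a, b, c are distinct vertices, and let Z be the set of vertices lying in none of t0, t1, t2. Suppose u, v ∈ Z are distinct, p and q are distinct elements of {a, b, c}, and {p, u, v} ∈ H and {q, u, v} ∈ H (a double edge uv). Then every triple f ∈ H with u ∈ f and |f ∩ {a, b, c}| = 1 satisfies f ∩ {a, b, c} ⊆ {p, q}, and likewise for every triple f ∈ H with v ∈ f and |f ∩ {a, b, c}| = 1 (multiple edges within Z lie inside some Z_{pq}). -/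
/-- A Berge-triangle `a, b, c` together with three distinct further triples joining a vertex `u`,
which lies in none of the triples of the triangle, to `a`, `b` and `c` is a Berge-`K₄`. -/
theorem HasBergeK4.of_cone {V : Type*} [DecidableEq V] {H : Finset (Finset V)} {a b c u : V}
    {tab tac tbc ea eb ec : Finset V}
    (hab : a ≠ b) (hac : a ≠ c) (hbc : b ≠ c)
    (htab : tab ∈ H) (htac : tac ∈ H) (htbc : tbc ∈ H)
    (h₁ : tab ≠ tac) (h₂ : tab ≠ tbc) (h₃ : tac ≠ tbc)
    (sab : {a, b} ⊆ tab) (sac : {a, c} ⊆ tac) (sbc : {b, c} ⊆ tbc)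
    (uab : u ∉ tab) (uac : u ∉ tac) (ubc : u ∉ tbc)
    (hea : ea ∈ H) (heb : eb ∈ H) (hec : ec ∈ H)
    (k₁ : ea ≠ eb) (k₂ : ea ≠ ec) (k₃ : eb ≠ ec)
    (sa : {a, u} ⊆ ea) (sb : {b, u} ⊆ eb) (sc : {c, u} ⊆ ec) :
    HasBergeK4 H := by
  simp only [Finset.insert_subset_iff, Finset.singleton_subset_iff] at sa sb sc sab sac sbc
  have hne {t e : Finset V} (ht : u ∉ t) (he : u ∈ e) : t ≠ e := fun h => ht (h ▸ he)
  refine ⟨a, b, c, u, tab, tac, ea, tbc, eb, ec, hab, hac, ?_, hbc, ?_, ?_, ?_,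
    htab, htac, hea, htbc, heb, hec, ?_⟩
  · exact ne_of_mem_of_not_mem sab.1 uab
  · exact ne_of_mem_of_not_mem sab.2 uab
  · exact ne_of_mem_of_not_mem sac.2 uac
  · simp [h₁, h₂, h₃, k₁, k₂, k₃, hne uab sa.2, hne uab sb.2, hne uab sc.2, hne uac sa.2,
      hne uac sb.2, hne uac sc.2, (hne ubc sa.2).symm, hne ubc sb.2, hne ubc sc.2]
  · simp [Finset.insert_subset_iff, sab, sac, sbc, sa, sb, sc]

/-- A double edge `uv` over a Berge-triangle confines the labels of the triples at `u`. -/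
theorem label_mem_of_double_edge {V : Type*} [DecidableEq V] {H : Finset (Finset V)}
    (hfree : ¬ HasBergeK4 H) {a b c : V} (hab : a ≠ b) (hac : a ≠ c) (hbc : b ≠ c)
    {t₁ t₂ : Finset V} (ht₀ : {a, b, c} ∈ H) (ht₁ : t₁ ∈ H) (ht₂ : t₂ ∈ H)
    (h01 : {a, b, c} ≠ t₁) (h02 : {a, b, c} ≠ t₂) (h12 : t₁ ≠ t₂)
    (habt₁ : {a, b} ⊆ t₁) (hbct₂ : {b, c} ⊆ t₂) {u v : V}
    (hu₀ : u ∉ ({a, b, c} : Finset V)) (hu₁ : u ∉ t₁) (hu₂ : u ∉ t₂)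
    (hv₀ : v ∉ ({a, b, c} : Finset V)) {p q : V}
    (hp : p ∈ ({a, b, c} : Finset V)) (hq : q ∈ ({a, b, c} : Finset V)) (hpq : p ≠ q)
    (hpuv : {p, u, v} ∈ H) (hquv : {q, u, v} ∈ H)
    {f : Finset V} (hf : f ∈ H) (huf : u ∈ f) :
    f ∩ {a, b, c} ⊆ {p, q} := by
  intro r hr
  obtain ⟨hrf, hr⟩ := Finset.mem_inter.mp hr
  by_contra hrpq
  have hpf : {p, u, v} ≠ f := by rintro rfl; grind
  have hqf : {q, u, v} ≠ f := by rintro rfl; grind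
  have hne : ({p, u, v} : Finset V) ≠ {q, u, v} := by
    intro h
    have : p ∈ ({q, u, v} : Finset V) := h ▸ Finset.mem_insert_self _ _
    grind
  have key {ea eb ec : Finset V} (hea : ea ∈ H) (heb : eb ∈ H) (hec : ec ∈ H)
      (k₁ : ea ≠ eb) (k₂ : ea ≠ ec) (k₃ : eb ≠ ec)
      (sa : {a, u} ⊆ ea) (sb : {b, u} ⊆ eb) (sc : {c, u} ⊆ ec) : False :=
    hfree <| .of_cone hab hac hbc ht₁ ht₀ ht₂ h01.symm h12 h02 habt₁
      (by simp [Finset.insert_subset_iff]) hbct₂ hu₁ hu₀ hu₂ hea heb hec k₁ k₂ k₃ sa sb sc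
  have sp : {p, u} ⊆ ({p, u, v} : Finset V) := by simp [Finset.insert_subset_iff]
  have sq : {q, u} ⊆ ({q, u, v} : Finset V) := by simp [Finset.insert_subset_iff]
  have sr : {r, u} ⊆ f := by simp [Finset.insert_subset_iff, hrf, huf]
  simp only [Finset.mem_insert, Finset.mem_singleton, not_or] at hp hq hr hrpq
  obtain ⟨hrp, hrq⟩ := hrpq
  rcases hp with rfl | rfl | rfl <;> rcases hq with rfl | rfl | rfl <;>
    rcases hr with rfl | rfl | rfl <;> first
    | contradiction
    | exact key hpuv hquv hf hne hpf hqf sp sq sr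
    | exact key hpuv hf hquv hpf hne hqf.symm sp sr sq
    | exact key hquv hpuv hf hne.symm hqf hpf sq sp sr
    | exact key hquv hf hpuv hqf hne.symm hpf.symm sq sr sp
    | exact key hf hpuv hquv hpf.symm hqf.symm hne sr sp sq
    | exact key hf hquv hpuv hqf.symm hpf.symm hne.symm sr sq sp

/-- In the trace on `{a,b,c}` of a Berge-`K₄`-free triple
system with a Berge-triangle `t₀, t₁, t₂`, a double edge `uv` (with labels
`p, q`) inside `Z` forces all edge labels at `u` and at `v` to lie in `{p,q}`. -/
theorem double_edge_labels
    (V : Type*) [DecidableEq V]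
    (H : Finset (Finset V)) (hH3 : ∀ t ∈ H, t.card = 3)
    (hfree : ¬ HasBergeK4 H)
    (a b c : V) (hab : a ≠ b) (hac : a ≠ c) (hbc : b ≠ c)
    (t₀ t₁ t₂ : Finset V) (ht₀ : t₀ ∈ H) (ht₁ : t₁ ∈ H) (ht₂ : t₂ ∈ H)
    (ht₀eq : t₀ = {a, b, c}) (h01 : t₀ ≠ t₁) (h02 : t₀ ≠ t₂) (h12 : t₁ ≠ t₂)
    (habt₁ : ({a, b} : Finset V) ⊆ t₁) (hbct₂ : ({b, c} : Finset V) ⊆ t₂)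
    (u v : V) (huv : u ≠ v)
    (hu₀ : u ∉ t₀) (hu₁ : u ∉ t₁) (hu₂ : u ∉ t₂)
    (hv₀ : v ∉ t₀) (hv₁ : v ∉ t₁) (hv₂ : v ∉ t₂)
    (p q : V) (hp : p ∈ ({a, b, c} : Finset V)) (hq : q ∈ ({a, b, c} : Finset V))
    (hpq : p ≠ q)
    (hpuv : ({p, u, v} : Finset V) ∈ H) (hquv : ({q, u, v} : Finset V) ∈ H) :
    (∀ f ∈ H, u ∈ f → (f ∩ ({a, b, c} : Finset V)).card = 1 →
      f ∩ ({a, b, c} : Finset V) ⊆ {p, q}) ∧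
    (∀ f ∈ H, v ∈ f → (f ∩ ({a, b, c} : Finset V)).card = 1 →
      f ∩ ({a, b, c} : Finset V) ⊆ {p, q}) := by
  subst ht₀eq
  refine ⟨fun f hf huf _ => ?_, fun f hf hvf _ => ?_⟩
  · exact label_mem_of_double_edge hfree hab hac hbc ht₀ ht₁ ht₂ h01 h02 h12 habt₁ hbct₂
      hu₀ hu₁ hu₂ hv₀ hp hq hpq hpuv hquv hf huf
  · rw [Finset.pair_comm] at hpuv hquv
    exact label_mem_of_double_edge hfree hab hac hbc ht₀ ht₁ ht₂ h01 h02 h12 habt₁ hbct₂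
      hv₀ hv₁ hv₂ hu₀ hp hq hpq hpuv hquv hf hvf
end

section
/- Let H be a Berge-K4-free triple system containing three pairwise distinct triples t0 = {a, b, c}, t1 with {a, b} ⊆ t1, and t2 with {b, c} ⊆ t2, where a, b, c are distinct vertices, and let Z be the set of vertices lying in none of t0, t1, t2. Suppose z1, z2, z3 ∈ Z are pairwise distinct, p and q are distinct elements of {a, b, c}, and the four triples {p, z1, z2}, {q, z1, z2}, {p, z2, z3}, {q, z2, z3} all belong to H (two incident double edges z1z2 and z2z3). Then there is no triple f ∈ H with z3 ∈ f, z2 ∉ f, and f ∩ {a, b, c} ≠ ∅; and symmetrically there is no triple f ∈ H with z1 ∈ f, z2 ∉ f, and f ∩ {a, b, c} ≠ ∅ (no further edges or loops of the trace on {a,b,c} at z1 or z3). -/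
/-- A triple through `z` that avoids `y` and meets a Berge triangle on `p, q, r` creates a
Berge-`K₄`, provided `xy` and `yz` are both double edges with labels `p` and `q`. -/
theorem hasBergeK4_of_triangle {V : Type*} [DecidableEq V] {H : Finset (Finset V)}
    {p q r x y z : V} {epq epr eqr f : Finset V}
    (hpq : p ≠ q) (hpr : p ≠ r) (hqr : q ≠ r) (hxz : x ≠ z) (hyz : y ≠ z)
    (hepq : epq ∈ H) (hepr : epr ∈ H) (heqr : eqr ∈ H)
    (hne₁ : epq ≠ epr) (hne₂ : epq ≠ eqr) (hne₃ : epr ≠ eqr)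
    (hpq_sub : {p, q} ⊆ epq) (hpr_sub : {p, r} ⊆ epr) (hqr_sub : {q, r} ⊆ eqr)
    (hx : x ∉ epq) (hy : y ∉ epq) (hz₁ : z ∉ epq) (hz₂ : z ∉ epr) (hz₃ : z ∉ eqr)
    (hpx : {p, x, y} ∈ H) (hqx : {q, x, y} ∈ H) (hpz : {p, y, z} ∈ H) (hqz : {q, y, z} ∈ H)
    (hf : f ∈ H) (hzf : z ∈ f) (hyf : y ∉ f) (hmeet : p ∈ f ∨ q ∈ f ∨ r ∈ f) :
    HasBergeK4 H := by
  have hp : p ∈ epq := hpq_sub (by simp)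
  have hq : q ∈ epq := hpq_sub (by simp)
  have hr : r ∈ epr := hpr_sub (by simp)
  have px : p ≠ x := fun h => hx (h ▸ hp)
  have py : p ≠ y := fun h => hy (h ▸ hp)
  have pz : p ≠ z := fun h => hz₁ (h ▸ hp)
  have qy : q ≠ y := fun h => hy (h ▸ hq)
  have qz : q ≠ z := fun h => hz₁ (h ▸ hq)
  have rz : r ≠ z := fun h => hz₂ (h ▸ hr)
  have y_ne {s t : Finset V} (hs : y ∉ s) (ht : y ∈ t) : s ≠ t :=
    (ne_of_mem_of_not_mem' ht hs).symm
  have z_ne {s t : Finset V} (hs : z ∉ s) (ht : z ∈ t) : s ≠ t :=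
    (ne_of_mem_of_not_mem' ht hs).symm
  have hzpx : z ∉ ({p, x, y} : Finset V) := by simp [pz.symm, hxz.symm, hyz.symm]
  have hzqx : z ∉ ({q, x, y} : Finset V) := by simp [qz.symm, hxz.symm, hyz.symm]
  have hx_ne : ({p, x, y} : Finset V) ≠ {q, x, y} :=
    ne_of_mem_of_not_mem' (a := p) (by simp) (by simp [hpq, px, py])
  have hz_ne : ({p, y, z} : Finset V) ≠ {q, y, z} :=
    ne_of_mem_of_not_mem' (a := p) (by simp) (by simp [hpq, py, pz])
  have hpzf : ({p, y, z} : Finset V) ≠ f := ne_of_mem_of_not_mem' (a := y) (by simp) hyf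
  have hqzf : ({q, y, z} : Finset V) ≠ f := ne_of_mem_of_not_mem' (a := y) (by simp) hyf
  have hpxf := z_ne hzpx hzf
  have hqxf := z_ne hzqx hzf
  have a₁ : epq ≠ {p, x, y} := y_ne hy (by simp)
  have a₂ : epq ≠ {q, x, y} := y_ne hy (by simp)
  have b₁ : epq ≠ {p, y, z} := z_ne hz₁ (by simp)
  have b₂ : epq ≠ {q, y, z} := z_ne hz₁ (by simp)
  have c₁ : ({p, x, y} : Finset V) ≠ {p, y, z} := z_ne hzpx (by simp)
  have c₂ : ({p, x, y} : Finset V) ≠ {q, y, z} := z_ne hzpx (by simp)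
  have c₃ : ({q, x, y} : Finset V) ≠ {p, y, z} := z_ne hzqx (by simp)
  have c₄ : ({q, x, y} : Finset V) ≠ {q, y, z} := z_ne hzqx (by simp)
  have d := z_ne hz₁ hzf
  rcases hmeet with hpf | hqf | hrf
  · refine ⟨p, q, y, z, epq, {p, x, y}, f, {q, x, y}, {q, y, z}, {p, y, z},
      hpq, py, pz, qy, qz, hyz, ?_, hepq, hpx, hf, hqx, hqz, hpz, hpq_sub, ?_, ?_, ?_, ?_, ?_⟩
    · simp only [List.nodup_cons, List.mem_cons, List.not_mem_nil, not_or,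
        not_false_eq_true, List.nodup_nil, and_true]
      exact ⟨⟨a₁, d, a₂, b₂, b₁⟩, ⟨hpxf, hx_ne, c₂, c₁⟩, ⟨hqxf.symm, hqzf.symm, hpzf.symm⟩,
        ⟨c₄, c₃⟩, hz_ne.symm⟩
    all_goals simp [Finset.insert_subset_iff, hpf, hzf]
  · refine ⟨p, q, y, z, epq, {p, x, y}, {p, y, z}, {q, x, y}, f, {q, y, z},
      hpq, py, pz, qy, qz, hyz, ?_, hepq, hpx, hpz, hqx, hf, hqz, hpq_sub, ?_, ?_, ?_, ?_, ?_⟩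
    · simp only [List.nodup_cons, List.mem_cons, List.not_mem_nil, not_or,
        not_false_eq_true, List.nodup_nil, and_true]
      exact ⟨⟨a₁, b₁, a₂, d, b₂⟩, ⟨c₁, hx_ne, hpxf, c₂⟩, ⟨c₃.symm, hpzf, hz_ne⟩,
        ⟨hqxf, c₄⟩, hqzf.symm⟩
    all_goals simp [Finset.insert_subset_iff, hqf, hzf]
  · refine ⟨p, q, r, z, epq, epr, {p, y, z}, eqr, {q, y, z}, f,
      hpq, hpr, pz, hqr, qz, rz, ?_, hepq, hepr, hpz, heqr, hqz, hf, hpq_sub, hpr_sub, ?_,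
      hqr_sub, ?_, ?_⟩
    · simp only [List.nodup_cons, List.mem_cons, List.not_mem_nil, not_or,
        not_false_eq_true, List.nodup_nil, and_true]
      exact ⟨⟨hne₁, b₁, hne₂, b₂, d⟩, ⟨z_ne hz₂ (by simp), hne₃, z_ne hz₂ (by simp), z_ne hz₂ hzf⟩,
        ⟨(z_ne hz₃ (by simp)).symm, hz_ne, hpzf⟩, ⟨z_ne hz₃ (by simp), z_ne hz₃ hzf⟩, hqzf⟩
    all_goals simp [Finset.insert_subset_iff, hrf, hzf]

/-- In the trace on `{a,b,c}` of a Berge-`K₄`-free triple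
system with a Berge-triangle `t₀, t₁, t₂`, if `z₁z₂` and `z₂z₃` are double
edges inside `y_ne hy (by simp)` with labels `p, q`, then no further edges or loops of the
trace occur at `z₁` or at `z₃`. -/
theorem incident_double_edges_pendant
    (V : Type*) [DecidableEq V]
    (H : Finset (Finset V)) (hH3 : ∀ t ∈ H, t.card = 3)
    (hfree : ¬ HasBergeK4 H)
    (a b c : V) (hab : a ≠ b) (hac : a ≠ c) (hbc : b ≠ c)
    (t₀ t₁ t₂ : Finset V) (ht₀ : t₀ ∈ H) (ht₁ : t₁ ∈ H) (ht₂ : t₂ ∈ H)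
    (ht₀eq : t₀ = {a, b, c}) (h01 : t₀ ≠ t₁) (h02 : t₀ ≠ t₂) (h12 : t₁ ≠ t₂)
    (habt₁ : ({a, b} : Finset V) ⊆ t₁) (hbct₂ : ({b, c} : Finset V) ⊆ t₂)
    (z₁ z₂ z₃ : V) (h12 : z₁ ≠ z₂) (h13 : z₁ ≠ z₃) (h23 : z₂ ≠ z₃)
    (hz₁₀ : z₁ ∉ t₀) (hz₁₁ : z₁ ∉ t₁) (hz₁₂ : z₁ ∉ t₂)
    (hz₂₀ : z₂ ∉ t₀) (hz₂₁ : z₂ ∉ t₁) (hz₂₂ : z₂ ∉ t₂)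
    (hz₃₀ : z₃ ∉ t₀) (hz₃₁ : z₃ ∉ t₁) (hz₃₂ : z₃ ∉ t₂)
    (p q : V) (hp : p ∈ ({a, b, c} : Finset V)) (hq : q ∈ ({a, b, c} : Finset V))
    (hpq : p ≠ q)
    (h1 : ({p, z₁, z₂} : Finset V) ∈ H) (h2 : ({q, z₁, z₂} : Finset V) ∈ H)
    (h3 : ({p, z₂, z₃} : Finset V) ∈ H) (h4 : ({q, z₂, z₃} : Finset V) ∈ H) :
    (¬ ∃ f ∈ H, z₃ ∈ f ∧ z₂ ∉ f ∧ (f ∩ ({a, b, c} : Finset V)).Nonempty) ∧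
    (¬ ∃ f ∈ H, z₁ ∈ f ∧ z₂ ∉ f ∧ (f ∩ ({a, b, c} : Finset V)).Nonempty) := by
  have hct₀ : ({a, c} : Finset V) ⊆ t₀ := by simp [ht₀eq, Finset.insert_subset_iff]
  have no_triple (x y z : V) (hxz : x ≠ z) (hyz : y ≠ z)
      (hx₀ : x ∉ t₀) (hx₁ : x ∉ t₁) (hx₂ : x ∉ t₂) (hy₀ : y ∉ t₀) (hy₁ : y ∉ t₁) (hy₂ : y ∉ t₂)
      (hz₀ : z ∉ t₀) (hz₁ : z ∉ t₁) (hz₂ : z ∉ t₂)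
      (hpx : {p, x, y} ∈ H) (hqx : {q, x, y} ∈ H) (hpz : {p, y, z} ∈ H) (hqz : {q, y, z} ∈ H) :
      ¬ ∃ f ∈ H, z ∈ f ∧ y ∉ f ∧ (f ∩ ({a, b, c} : Finset V)).Nonempty := by
    rintro ⟨f, hf, hzf, hyf, w, hw⟩
    have hmeet : a ∈ f ∨ b ∈ f ∨ c ∈ f := by
      simp only [Finset.mem_inter, Finset.mem_insert, Finset.mem_singleton] at hw
      rcases hw with ⟨hwf, rfl | rfl | rfl⟩ <;> simp [hwf]
    obtain ⟨r, epq, epr, eqr, hpr, hqr, hepq, hepr, heqr, hne₁, hne₂, hne₃, spq, spr, sqr,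
        hx, hy, hz, hz', hz'', hm⟩ : ∃ (r : V) (epq epr eqr : Finset V), p ≠ r ∧ q ≠ r ∧
        epq ∈ H ∧ epr ∈ H ∧ eqr ∈ H ∧ epq ≠ epr ∧ epq ≠ eqr ∧ epr ≠ eqr ∧
        {p, q} ⊆ epq ∧ {p, r} ⊆ epr ∧ {q, r} ⊆ eqr ∧ x ∉ epq ∧ y ∉ epq ∧
        z ∉ epq ∧ z ∉ epr ∧ z ∉ eqr ∧ (p ∈ f ∨ q ∈ f ∨ r ∈ f) := by
      have ht₁₂ : t₁ ≠ t₂ := by assumption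
      have hba : ({b, a} : Finset V) ⊆ t₁ := Finset.pair_comm a b ▸ habt₁
      have hcb : ({c, b} : Finset V) ⊆ t₂ := Finset.pair_comm b c ▸ hbct₂
      have hca : ({c, a} : Finset V) ⊆ t₀ := Finset.pair_comm a c ▸ hct₀
      simp only [Finset.mem_insert, Finset.mem_singleton] at hp hq
      rcases hp with rfl | rfl | rfl <;> rcases hq with rfl | rfl | rfl
      · exact absurd rfl hpq
      · exact ⟨c, t₁, t₀, t₂, hac, hbc, ht₁, ht₀, ht₂,
          h01.symm, ht₁₂, h02, habt₁, hct₀, hbct₂,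
          hx₁, hy₁, hz₁, hz₀, hz₂, by grind⟩
      · exact ⟨b, t₀, t₁, t₂, hab, hbc.symm, ht₀, ht₁, ht₂,
          h01, h02, ht₁₂, hct₀, habt₁, hcb,
          hx₀, hy₀, hz₀, hz₁, hz₂, by grind⟩
      · exact ⟨c, t₁, t₂, t₀, hbc, hac, ht₁, ht₂, ht₀,
          ht₁₂, h01.symm, h02.symm, hba, hbct₂, hct₀,
          hx₁, hy₁, hz₁, hz₂, hz₀, by grind⟩
      · exact absurd rfl hpq
      · exact ⟨a, t₂, t₁, t₀, hab.symm, hac.symm, ht₂, ht₁, ht₀,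
          ht₁₂.symm, h02.symm, h01.symm, hbct₂, hba, hca,
          hx₂, hy₂, hz₂, hz₁, hz₀, by grind⟩
      · exact ⟨b, t₀, t₂, t₁, hbc.symm, hab, ht₀, ht₂, ht₁,
          h02, h01, ht₁₂.symm, hca, hcb, habt₁,
          hx₀, hy₀, hz₀, hz₂, hz₁, by grind⟩
      · exact ⟨a, t₂, t₀, t₁, hac.symm, hab.symm, ht₂, ht₀, ht₁,
          h02.symm, ht₁₂.symm, h01, hcb, hca, hba,
          hx₂, hy₂, hz₂, hz₀, hz₁, by grind⟩
      · exact absurd rfl hpq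
    exact hfree (hasBergeK4_of_triangle hpq hpr hqr hxz hyz hepq hepr heqr hne₁ hne₂ hne₃
      spq spr sqr hx hy hz hz' hz'' hpx hqx hpz hqz hf hzf hyf hm)
  refine ⟨no_triple z₁ z₂ z₃ h13 h23 hz₁₀ hz₁₁ hz₁₂ hz₂₀ hz₂₁ hz₂₂ hz₃₀ hz₃₁ hz₃₂ h1 h2 h3 h4,
    no_triple z₃ z₂ z₁ h13.symm h12.symm hz₃₀ hz₃₁ hz₃₂ hz₂₀ hz₂₁ hz₂₂ hz₁₀ hz₁₁ hz₁₂ ?_ ?_ ?_ ?_⟩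
  all_goals rwa [Finset.pair_comm]
end

section
/- Let H be a Berge-K4-free triple system and let a, b, c, x, z be five distinct vertices such that the five triples {a, b, c}, {a, b, x}, {a, c, x}, {b, c, x} (a K_4^3 on {a,b,c,x}) and {a, x, z} all belong to H. Then H contains no triple of the form {p, q, w} where p, q are distinct elements of {a, b, c} and w ∉ {a, b, c, x} (no vertex outside {a,b,c,x} carries a loop in the trace on {a,b,c}). -/
/-- If a Berge-`K₄`-free triple system contains a `K₄³` on
`{a,b,c,x}` together with a triple `{a,x,z}` (where `a,b,c,x,z` are distinct),
then no vertex outside `{a,b,c,x}` carries a loop in the trace on `{a,b,c}`: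
no triple `{p,q,w}` with `p ≠ q` in `{a,b,c}` and `w ∉ {a,b,c,x}` belongs
to `H`. -/
theorem k43_no_outside_loop
    (V : Type*) [DecidableEq V]
    (H : Finset (Finset V)) (hH3 : ∀ t ∈ H, t.card = 3)
    (hfree : ¬ HasBergeK4 H)
    (a b c x z : V) (hdist : ([a, b, c, x, z] : List V).Nodup)
    (h₁ : ({a, b, c} : Finset V) ∈ H) (h₂ : ({a, b, x} : Finset V) ∈ H)
    (h₃ : ({a, c, x} : Finset V) ∈ H) (h₄ : ({b, c, x} : Finset V) ∈ H)
    (h₅ : ({a, x, z} : Finset V) ∈ H) :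
    ∀ p q w : V, p ∈ ({a, b, c} : Finset V) → q ∈ ({a, b, c} : Finset V) →
      p ≠ q → w ∉ ({a, b, c, x} : Finset V) →
      ({p, q, w} : Finset V) ∉ H := by
  intro p q w hp hq hpq hw hH
  simp only [List.nodup_cons, List.mem_cons, List.not_mem_nil, or_false, not_or] at hdist
  simp only [Finset.mem_insert, Finset.mem_singleton, not_or] at hp hq hw
  obtain ⟨⟨hab, hac, hax, haz⟩, ⟨hbc, hbx, hbz⟩, ⟨hcx, hcz⟩, -⟩ := hdist
  have hpair : ({p, q, w} : Finset V) = {a, b, w} ∨ ({p, q, w} : Finset V) = {a, c, w} ∨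
      ({p, q, w} : Finset V) = {b, c, w} := by
    rcases hp with rfl | rfl | rfl <;> rcases hq with rfl | rfl | rfl <;>
      simp_all [Finset.insert_comm]
  have hmem {s t : Finset V} (h : s = t) :
      (a ∈ s ↔ a ∈ t) ∧ (b ∈ s ↔ b ∈ t) ∧ (c ∈ s ↔ c ∈ t) ∧ (x ∈ s ↔ x ∈ t) := by
    simp [h]
  apply hfree
  rcases hpair with h | h | h <;> rw [h] at hH
  · refine ⟨a, b, c, x, {a, b, w}, {a, b, c}, {a, x, z}, {b, c, x}, {a, b, x}, {a, c, x},
      hab, hac, hax, hbc, hbx, hcx, ?_, hH, h₁, h₅, h₄, h₂, h₃, by simp [Finset.insert_subset_iff]⟩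
    simp only [List.nodup_cons, List.mem_cons, List.not_mem_nil, or_false, not_or]
    refine ⟨⟨?_, ?_, ?_, ?_, ?_⟩, ⟨?_, ?_, ?_, ?_⟩, ⟨?_, ?_, ?_⟩, ⟨?_, ?_⟩, ?_, by simp⟩ <;>
      exact fun h ↦ by
        have := hmem h
        clear h
        simp only [Finset.mem_insert, Finset.mem_singleton] at this
        grind only
  · refine ⟨a, b, c, x, {a, b, c}, {a, c, w}, {a, x, z}, {b, c, x}, {a, b, x}, {a, c, x},
      hab, hac, hax, hbc, hbx, hcx, ?_, h₁, hH, h₅, h₄, h₂, h₃, by simp [Finset.insert_subset_iff]⟩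
    simp only [List.nodup_cons, List.mem_cons, List.not_mem_nil, or_false, not_or]
    refine ⟨⟨?_, ?_, ?_, ?_, ?_⟩, ⟨?_, ?_, ?_, ?_⟩, ⟨?_, ?_, ?_⟩, ⟨?_, ?_⟩, ?_, by simp⟩ <;>
      exact fun h ↦ by
        have := hmem h
        clear h
        simp only [Finset.mem_insert, Finset.mem_singleton] at this
        grind only
  · refine ⟨a, b, c, x, {a, b, c}, {a, c, x}, {a, x, z}, {b, c, w}, {a, b, x}, {b, c, x},
      hab, hac, hax, hbc, hbx, hcx, ?_, h₁, h₃, h₅, hH, h₂, h₄, by simp [Finset.insert_subset_iff]⟩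
    simp only [List.nodup_cons, List.mem_cons, List.not_mem_nil, or_false, not_or]
    refine ⟨⟨?_, ?_, ?_, ?_, ?_⟩, ⟨?_, ?_, ?_, ?_⟩, ⟨?_, ?_, ?_⟩, ⟨?_, ?_⟩, ?_, by simp⟩ <;>
      exact fun h ↦ by
        have := hmem h
        clear h
        simp only [Finset.mem_insert, Finset.mem_singleton] at this
        grind only
end

section
/- Let H be a Berge-K4-free triple system containing three pairwise distinct triples t0 = {a, b, c}, t1 with {a, b} ⊆ t1, and t2 with {b, c} ⊆ t2, where a, b, c are distinct vertices, and let Z be the set of vertices lying in none of t0, t1, t2. Suppose z1, z2 ∈ Z are distinct, p and q are distinct elements of {a, b, c}, and the four triples {p, z1, z2}, {q, z1, z2}, {p, q, z1}, {p, q, z2} all belong to H (a dumbbell: a double edge z1z2 with a loop at each end). Then every triple f ∈ H with z1 ∈ f, z2 ∉ f and f ≠ {p, q, z1} satisfies f ∩ {a, b, c} = ∅ (the dumbbell is a connected component of the trace on {a,b,c}). -/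
/-- Three distinct triples forming a Berge triangle on `{a, b, c}`, together with three distinct
triples joining a vertex `z` outside the former to `a`, `b`, `c`, yield a Berge-`K₄`. -/
theorem HasBergeK4.of_triangle_of_star {V : Type*} [DecidableEq V] {H : Finset (Finset V)}
    {a b c z : V} {s t u x y w : Finset V} (hab : a ≠ b) (hac : a ≠ c) (hbc : b ≠ c)
    (hs : s ∈ H) (ht : t ∈ H) (hu : u ∈ H) (hst : s ≠ t) (hsu : s ≠ u) (htu : t ≠ u)
    (habs : {a, b} ⊆ s) (hact : {a, c} ⊆ t) (hbcu : {b, c} ⊆ u)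
    (hzs : z ∉ s) (hzt : z ∉ t) (hzu : z ∉ u)
    (hx : x ∈ H) (hy : y ∈ H) (hw : w ∈ H) (hxy : x ≠ y) (hxw : x ≠ w) (hyw : y ≠ w)
    (hax : a ∈ x) (hby : b ∈ y) (hcw : c ∈ w) (hzx : z ∈ x) (hzy : z ∈ y) (hzw : z ∈ w) :
    HasBergeK4 H := by
  simp only [Finset.insert_subset_iff, Finset.singleton_subset_iff] at habs hact hbcu
  refine ⟨a, b, c, z, s, t, x, u, y, w, hab, hac, by grind, hbc, by grind, by grind,
    ?_, hs, ht, hx, hu, hy, hw, ?_⟩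
  · have out : ∀ {g h : Finset V}, z ∉ g → z ∈ h → g ≠ h := fun hg hh =>
      (ne_of_mem_of_not_mem' hh hg).symm
    simp only [List.nodup_cons, List.mem_cons, List.not_mem_nil, List.nodup_nil, not_or,
      not_false_eq_true, and_true]
    exact ⟨⟨hst, out hzs hzx, hsu, out hzs hzy, out hzs hzw⟩,
      ⟨out hzt hzx, htu, out hzt hzy, out hzt hzw⟩,
      ⟨(out hzu hzx).symm, hxy, hxw⟩, ⟨out hzu hzy, out hzu hzw⟩, hyw⟩
  · simp only [Finset.insert_subset_iff, Finset.singleton_subset_iff]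
    grind

/-- A dumbbell on `p, q, z₁, z₂` together with a further triple through `p, q` and a further
triple through `p, z₁` yields a Berge-`K₄`. -/
theorem HasBergeK4.of_dumbbell {V : Type*} [DecidableEq V] {H : Finset (Finset V)}
    {p q z₁ z₂ : V} {t f : Finset V} (hpq : p ≠ q) (hz : z₁ ≠ z₂)
    (ht : t ∈ H) (hpt : p ∈ t) (hqt : q ∈ t) (hz₁t : z₁ ∉ t) (hz₂t : z₂ ∉ t)
    (hf : f ∈ H) (hpf : p ∈ f) (hz₁f : z₁ ∈ f) (hz₂f : z₂ ∉ f) (hfne : f ≠ {p, q, z₁})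
    (h1 : {p, z₁, z₂} ∈ H) (h2 : {q, z₁, z₂} ∈ H)
    (h3 : {p, q, z₁} ∈ H) (h4 : {p, q, z₂} ∈ H) : HasBergeK4 H := by
  have hpz₁ : p ≠ z₁ := by grind
  have hpz₂ : p ≠ z₂ := by grind
  have hqz₁ : q ≠ z₁ := by grind
  have hqz₂ : q ≠ z₂ := by grind
  refine ⟨p, q, z₁, z₂, t, f, {p, q, z₂}, {p, q, z₁}, {q, z₁, z₂}, {p, z₁, z₂},
    hpq, hpz₁, hpz₂, hqz₁, hqz₂, hz, ?_, ht, hf, h4, h3, h2, h1, ?_⟩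
  · simp only [List.nodup_cons, List.mem_cons, List.not_mem_nil, List.nodup_nil, not_or,
      not_false_eq_true, and_true]
    refine ⟨⟨?_, ?_, ?_, ?_, ?_⟩, ⟨?_, hfne, ?_, ?_⟩, ⟨?_, ?_, ?_⟩, ⟨?_, ?_⟩, ?_⟩
    · exact (ne_of_mem_of_not_mem' hz₁f hz₁t).symm
    · exact (ne_of_mem_of_not_mem' (by simp) hz₂t).symm
    · exact (ne_of_mem_of_not_mem' (by simp) hz₁t).symm
    · exact (ne_of_mem_of_not_mem' (by simp) hz₁t).symm
    · exact (ne_of_mem_of_not_mem' (by simp) hz₁t).symm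
    · exact (ne_of_mem_of_not_mem' (by simp) hz₂f).symm
    · exact (ne_of_mem_of_not_mem' (by simp) hz₂f).symm
    · exact (ne_of_mem_of_not_mem' (by simp) hz₂f).symm
    · exact ne_of_mem_of_not_mem' (a := z₂) (by simp) (by grind)
    · exact ne_of_mem_of_not_mem' (a := p) (by simp) (by grind)
    · exact ne_of_mem_of_not_mem' (a := q) (by simp) (by grind)
    · exact ne_of_mem_of_not_mem' (a := p) (by simp) (by grind)
    · exact ne_of_mem_of_not_mem' (a := q) (by simp) (by grind)
    · exact ne_of_mem_of_not_mem' (a := q) (by simp) (by grind)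
  · simp only [Finset.insert_subset_iff, Finset.singleton_subset_iff]
    grind

/-- In the trace on `{a,b,c}` of a Berge-`K₄`-free triple
system with a Berge-triangle `t₀, t₁, t₂`, a dumbbell (a double edge `z₁z₂`
with labels `p, q` and loops `{p,q,z₁}`, `{p,q,z₂}`) is a connected component:
every further triple through `z₁` avoiding `z₂` misses `{a,b,c}`. -/
theorem dumbbell_is_component
    (V : Type*) [DecidableEq V]
    (H : Finset (Finset V)) (hH3 : ∀ t ∈ H, t.card = 3)
    (hfree : ¬ HasBergeK4 H)
    (a b c : V) (hab : a ≠ b) (hac : a ≠ c) (hbc : b ≠ c)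
    (t₀ t₁ t₂ : Finset V) (ht₀ : t₀ ∈ H) (ht₁ : t₁ ∈ H) (ht₂ : t₂ ∈ H)
    (ht₀eq : t₀ = {a, b, c}) (h01 : t₀ ≠ t₁) (h02 : t₀ ≠ t₂) (h12 : t₁ ≠ t₂)
    (habt₁ : ({a, b} : Finset V) ⊆ t₁) (hbct₂ : ({b, c} : Finset V) ⊆ t₂)
    (z₁ z₂ : V) (h12 : z₁ ≠ z₂)
    (hz₁₀ : z₁ ∉ t₀) (hz₁₁ : z₁ ∉ t₁) (hz₁₂ : z₁ ∉ t₂)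
    (hz₂₀ : z₂ ∉ t₀) (hz₂₁ : z₂ ∉ t₁) (hz₂₂ : z₂ ∉ t₂)
    (p q : V) (hp : p ∈ ({a, b, c} : Finset V)) (hq : q ∈ ({a, b, c} : Finset V))
    (hpq : p ≠ q)
    (h1 : ({p, z₁, z₂} : Finset V) ∈ H) (h2 : ({q, z₁, z₂} : Finset V) ∈ H)
    (h3 : ({p, q, z₁} : Finset V) ∈ H) (h4 : ({p, q, z₂} : Finset V) ∈ H) :
    ∀ f ∈ H, z₁ ∈ f → z₂ ∉ f → f ≠ ({p, q, z₁} : Finset V) →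
      f ∩ ({a, b, c} : Finset V) = ∅ := by
  rename_i ht₁₂
  intro f hf hz₁f hz₂f hfne
  subst ht₀eq
  by_cases hpf : p ∈ f
  · exact (hfree (.of_dumbbell hpq h12 ht₀ hp hq hz₁₀ hz₂₀ hf hpf hz₁f hz₂f hfne h1 h2 h3 h4)).elim
  by_cases hqf : q ∈ f
  · rw [Finset.insert_comm] at hfne h3 h4
    exact (hfree (.of_dumbbell hpq.symm h12 ht₀ hq hp hz₁₀ hz₂₀ hf hqf hz₁f hz₂f hfne
      h2 h1 h3 h4)).elim
  by_contra hne
  obtain ⟨r, hr⟩ := Finset.nonempty_iff_ne_empty.mpr hne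
  obtain ⟨hrf, hr⟩ := Finset.mem_inter.mp hr
  have hP : ({p, z₁, z₂} : Finset V) ≠ {q, z₁, z₂} :=
    ne_of_mem_of_not_mem' (a := p) (by simp) (by grind)
  have hPf : ({p, z₁, z₂} : Finset V) ≠ f := by grind
  have hQf : ({q, z₁, z₂} : Finset V) ≠ f := by grind
  have star : ∀ x ∈ H, ∀ y ∈ H, ∀ w ∈ H, x ≠ y → x ≠ w → y ≠ w → a ∈ x → b ∈ y → c ∈ w →
      z₁ ∈ x → z₁ ∈ y → z₁ ∈ w → False := by
    intro x hx y hy w hw hxy hxw hyw hax hby hcw hzx hzy hzw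
    exact hfree (.of_triangle_of_star hab hac hbc ht₁ ht₀ ht₂ h01.symm ht₁₂ h02 habt₁ (by simp)
      hbct₂ hz₁₁ hz₁₀ hz₁₂ hx hy hw hxy hxw hyw hax hby hcw hzx hzy hzw)
  have hrp : r ≠ p := by rintro rfl; exact hpf hrf
  have hrq : r ≠ q := by rintro rfl; exact hqf hrf
  have hzP : z₁ ∈ ({p, z₁, z₂} : Finset V) := by simp
  have hzQ : z₁ ∈ ({q, z₁, z₂} : Finset V) := by simp
  have hpP : p ∈ ({p, z₁, z₂} : Finset V) := by simp
  have hqQ : q ∈ ({q, z₁, z₂} : Finset V) := by simp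
  generalize ({p, z₁, z₂} : Finset V) = P at *
  generalize ({q, z₁, z₂} : Finset V) = Q at *
  simp only [Finset.mem_insert, Finset.mem_singleton] at hp hq hr
  rcases hp with rfl | rfl | rfl <;> rcases hq with rfl | rfl | rfl <;>
    rcases hr with rfl | rfl | rfl <;> grind
end

section
/- Let a, b, c, x, z, z' be six distinct vertices and let i ∈ {b, c}. If a triple system H contains the six pairwise distinct triples {a, b, c}, {a, b, x}, {a, x, z}, {i, x, z}, {a, z, z'}, {i, z, z'}, then H contains a Berge-K4 (spanned by the four vertices a, i, x, z). In particular, a Berge-K4-free triple system contains no such configuration (it is impossible to have double edges xz and zz' with the same label pair in the trace on {a,b,c}). -/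
/-- If `a, b, c, x, z, z'` are six distinct vertices,
`i ∈ {b, c}`, and the triple system `H` contains the six triples
`{a,b,c}, {a,b,x}, {a,x,z}, {i,x,z}, {a,z,z'}, {i,z,z'}`, then `H` contains a
Berge-`K₄` (spanned by `a, i, x, z`). -/
theorem double_edges_same_label_bergeK4
    (V : Type*) [DecidableEq V]
    (H : Finset (Finset V)) (hH3 : ∀ t ∈ H, t.card = 3)
    (a b c x z z' : V) (hdist : ([a, b, c, x, z, z'] : List V).Nodup)
    (i : V) (hi : i = b ∨ i = c)
    (h₁ : ({a, b, c} : Finset V) ∈ H) (h₂ : ({a, b, x} : Finset V) ∈ H)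
    (h₃ : ({a, x, z} : Finset V) ∈ H) (h₄ : ({i, x, z} : Finset V) ∈ H)
    (h₅ : ({a, z, z'} : Finset V) ∈ H) (h₆ : ({i, z, z'} : Finset V) ∈ H) :
    HasBergeK4 H := by
  simp only [List.nodup_cons, List.mem_cons, List.not_mem_nil, or_false, not_or] at hdist
  refine ⟨a, i, x, z, {a, b, c}, {a, b, x}, {a, z, z'}, {i, x, z}, {i, z, z'}, {a, x, z},
    by grind, by grind, by grind, by grind, by grind, by grind, ?_, h₁, h₂, h₅, h₄, h₆, h₃,
    by grind, by grind, by grind, by grind, by grind, by grind⟩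
  simp only [List.nodup_cons, List.mem_cons, List.not_mem_nil, or_false, not_or,
    not_false_eq_true, List.nodup_nil, and_true]
  refine ⟨⟨?_, ?_, ?_, ?_, ?_⟩, ⟨?_, ?_, ?_, ?_⟩, ⟨?_, ?_, ?_⟩, ⟨?_, ?_⟩, ?_⟩ <;>
  · intro h
    have ha := Finset.ext_iff.1 h a
    have hx := Finset.ext_iff.1 h x
    have hz := Finset.ext_iff.1 h z
    have hz' := Finset.ext_iff.1 h z'
    clear h
    grind
end
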